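/- arXiv:1006.3013 — 6 statements merged into one kernel-verified Lean document; each statement's English description precedes it below -/
import Mathlib

section
/- For every natural number n, the number of matchings on [2n] with no left-nestings is exactly n!. -/
/-- A matching on `[2n] = {1, …, 2n}`: a finite set of pairs `(a, b)` with `a < b`,
whose endpoints are exactly `{1, …, 2n}`, with all endpoints pairwise distinct. -/
def IsMatching (n : ℕ) (X : Finset (ℕ × ℕ)) : Prop :=
  (∀ p ∈ X, p.1 < p.2) ∧
  (∀ i : ℕ, (1 ≤ i ∧ i ≤ 2 * n) ↔ ∃ p ∈ X, i = p.1 ∨ i = p.2) ∧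
  (∀ p ∈ X, ∀ q ∈ X, p ≠ q → p.1 ≠ q.1 ∧ p.1 ≠ q.2 ∧ p.2 ≠ q.1 ∧ p.2 ≠ q.2)

/-- A left-nesting: pairs `(a, b), (c, d) ∈ X` with `a < c < d < b` and `c = a + 1`. -/
def HasLeftNesting (X : Finset (ℕ × ℕ)) : Prop :=
  ∃ p ∈ X, ∃ q ∈ X, q.1 = p.1 + 1 ∧ q.1 < q.2 ∧ q.2 < p.2

/-- The order embedding of `ℕ` into itself whose range omits exactly `a`. -/
def skipAt (a i : ℕ) : ℕ := if i < a then i else i + 1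

lemma skipAt_ne (a i : ℕ) : skipAt a i ≠ a := by
  unfold skipAt; split_ifs <;> omega

lemma skipAt_lt_skipAt {a i j : ℕ} : skipAt a i < skipAt a j ↔ i < j := by
  unfold skipAt; split_ifs <;> omega

lemma skipAt_injective (a : ℕ) : Function.Injective (skipAt a) := by
  intro i j h
  unfold skipAt at h; split_ifs at h <;> omega

lemma exists_skipAt_eq {a j : ℕ} (h : j ≠ a) : ∃ i, skipAt a i = j := by
  rcases lt_or_gt_of_ne h with h | h
  · exact ⟨j, by simp [skipAt, h]⟩
  · exact ⟨j - 1, by unfold skipAt; split_ifs <;> omega⟩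

/-- Insert into `X` a new arc opening at `a` and closing at `2 * n + 2`, relabelling the points
of `X` so as to make room for `a`. -/
def insertArc (n : ℕ) (X : Finset (ℕ × ℕ)) (a : ℕ) : Finset (ℕ × ℕ) :=
  insert (a, 2 * n + 2) (X.image (Prod.map (skipAt a) (skipAt a)))

lemma mem_insertArc {n a : ℕ} {X : Finset (ℕ × ℕ)} {q : ℕ × ℕ} :
    q ∈ insertArc n X a ↔
      q = (a, 2 * n + 2) ∨ ∃ p ∈ X, (skipAt a p.1, skipAt a p.2) = q := by
  simp only [insertArc, Finset.mem_insert, Finset.mem_image, Prod.map]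

lemma skipAt_mem_insertArc {n a : ℕ} {X : Finset (ℕ × ℕ)} {p : ℕ × ℕ} :
    (skipAt a p.1, skipAt a p.2) ∈ insertArc n X a ↔ p ∈ X := by
  rw [mem_insertArc]
  constructor
  · rintro (h | ⟨q, hq, h⟩)
    · exact absurd (Prod.ext_iff.1 h).1 (skipAt_ne _ _)
    · rw [Prod.ext_iff] at h
      rwa [← Prod.ext (skipAt_injective a h.1) (skipAt_injective a h.2)]
  · exact fun h => Or.inr ⟨p, h, rfl⟩

namespace IsMatching

variable {n : ℕ} {X : Finset (ℕ × ℕ)}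

lemma bounds (h : IsMatching n X) {p : ℕ × ℕ} (hp : p ∈ X) :
    1 ≤ p.1 ∧ p.1 < p.2 ∧ p.2 ≤ 2 * n :=
  ⟨((h.2.1 p.1).2 ⟨p, hp, Or.inl rfl⟩).1, h.1 p hp, ((h.2.1 p.2).2 ⟨p, hp, Or.inr rfl⟩).2⟩

lemma card_eq (h : IsMatching n X) : X.card = n := by
  have hU : Finset.Icc 1 (2 * n) = X.image Prod.fst ∪ X.image Prod.snd := by
    ext i
    rw [Finset.mem_Icc, h.2.1 i]
    simp only [Finset.mem_union, Finset.mem_image]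
    grind
  have hD : Disjoint (X.image Prod.fst) (X.image Prod.snd) := by
    rw [Finset.disjoint_left]
    simp only [Finset.mem_image]
    rintro i ⟨p, hp, rfl⟩ ⟨q, hq, hpq⟩
    by_cases e : p = q
    · subst e; have := h.1 p hp; omega
    · exact (h.2.2 p hp q hq e).2.1 hpq.symm
  have h1 : (X.image Prod.fst).card = X.card := Finset.card_image_of_injOn fun p hp q hq e => by
    by_contra hne; exact (h.2.2 p hp q hq hne).1 e
  have h2 : (X.image Prod.snd).card = X.card := Finset.card_image_of_injOn fun p hp q hq e => by
    by_contra hne; exact (h.2.2 p hp q hq hne).2.2.2 e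
  have := congrArg Finset.card hU
  rw [Finset.card_union_of_disjoint hD, h1, h2, Nat.card_Icc] at this
  omega

lemma card_closers (h : IsMatching n X) : (X.image Prod.snd).card = n := by
  rw [Finset.card_image_of_injOn, h.card_eq]
  intro p hp q hq e
  by_contra hne; exact (h.2.2 p hp q hq hne).2.2.2 e

end IsMatching

lemma isMatching_insertArc_iff {n a : ℕ} {X : Finset (ℕ × ℕ)} (h1 : 1 ≤ a) (h2 : a ≤ 2 * n + 1) :
    IsMatching (n + 1) (insertArc n X a) ↔ IsMatching n X := by
  have hb : ∀ i, (1 ≤ i ∧ i ≤ 2 * n) ↔ (1 ≤ skipAt a i ∧ skipAt a i ≤ 2 * n + 1) := by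
    intro i; unfold skipAt; split_ifs <;> omega
  constructor
  · intro h
    refine ⟨fun p hp => ?_, fun i => ?_, fun p hp q hq hpq => ?_⟩
    · exact skipAt_lt_skipAt.1 (h.1 _ (skipAt_mem_insertArc.2 hp))
    · rw [hb]
      constructor
      · intro hi
        obtain ⟨q, hq, hiq⟩ := (h.2.1 (skipAt a i)).1 (by omega)
        rcases mem_insertArc.1 hq with rfl | ⟨p, hp, rfl⟩
        · have := skipAt_ne a i
          simp only at hiq
          omega
        · exact ⟨p, hp, hiq.imp (fun e => skipAt_injective a e) (fun e => skipAt_injective a e)⟩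
      · rintro ⟨p, hp, hip⟩
        have hp' := skipAt_mem_insertArc (n := n) (a := a).2 hp
        have hr := (h.2.1 (skipAt a i)).2 ⟨_, hp', hip.imp (congrArg _) (congrArg _)⟩
        have hne := h.2.2 _ hp' (a, 2 * n + 2) (mem_insertArc.2 (Or.inl rfl))
          (fun e => skipAt_ne _ _ (Prod.ext_iff.1 e).1)
        simp only at hne
        rcases hip with rfl | rfl <;> omega
    · have := h.2.2 _ (skipAt_mem_insertArc.2 hp) _ (skipAt_mem_insertArc.2 hq) (fun e => hpq
        (Prod.ext (skipAt_injective a (Prod.ext_iff.1 e).1)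
          (skipAt_injective a (Prod.ext_iff.1 e).2)))
      simpa only [ne_eq, (skipAt_injective a).eq_iff] using this
  · intro h
    have hlt : ∀ p ∈ X, skipAt a p.1 ≤ 2 * n + 1 ∧ skipAt a p.2 ≤ 2 * n + 1 := fun p hp =>
      have := h.bounds hp
      ⟨((hb p.1).1 (by omega)).2, ((hb p.2).1 (by omega)).2⟩
    refine ⟨fun p hp => ?_, fun i => ?_, fun p hp q hq hpq => ?_⟩
    · rcases mem_insertArc.1 hp with rfl | ⟨p, hpX, rfl⟩
      · simp only; omega
      · exact skipAt_lt_skipAt.2 (h.1 p hpX)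
    · constructor
      · intro hi
        by_cases hia : i = a
        · exact ⟨_, mem_insertArc.2 (Or.inl rfl), Or.inl hia⟩
        by_cases hin : i = 2 * n + 2
        · exact ⟨_, mem_insertArc.2 (Or.inl rfl), Or.inr hin⟩
        obtain ⟨j, rfl⟩ := exists_skipAt_eq hia
        obtain ⟨p, hp, hjp⟩ := (h.2.1 j).1 ((hb j).2 (by omega))
        exact ⟨_, skipAt_mem_insertArc.2 hp, hjp.imp (congrArg _) (congrArg _)⟩
      · rintro ⟨q, hq, hiq⟩
        rcases mem_insertArc.1 hq with rfl | ⟨p, hp, rfl⟩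
        · simp only at hiq; omega
        · have := h.bounds hp
          have := (hb p.1).1 (by omega)
          have := (hb p.2).1 (by omega)
          simp only at hiq
          omega
    · rcases mem_insertArc.1 hp with rfl | ⟨p, hpX, rfl⟩ <;>
        rcases mem_insertArc.1 hq with rfl | ⟨q, hqX, rfl⟩
      · exact absurd rfl hpq
      · have := hlt q hqX
        have := skipAt_ne a q.1
        have := skipAt_ne a q.2
        simp only; omega
      · have := hlt p hpX
        have := skipAt_ne a p.1
        have := skipAt_ne a p.2
        simp only; omega
      · simpa only [ne_eq, (skipAt_injective a).eq_iff] using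
          h.2.2 p hpX q hqX (fun e => hpq (by rw [e]))

lemma not_hasLeftNesting_insertArc_iff {n a : ℕ} {X : Finset (ℕ × ℕ)} (h : IsMatching n X)
    (h1 : 1 ≤ a) (h2 : a ≤ 2 * n + 1) :
    ¬ HasLeftNesting (insertArc n X a) ↔
      ¬ HasLeftNesting X ∧ a ∈ insert (2 * n + 1) (X.image Prod.snd) := by
  have hnew : (a, 2 * n + 2) ∈ insertArc n X a := mem_insertArc.2 (Or.inl rfl)
  have hopen : ∀ q ∈ X, q.1 = a → HasLeftNesting (insertArc n X a) := by
    intro q hq hqa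
    have := h.bounds hq
    refine ⟨_, hnew, _, skipAt_mem_insertArc.2 hq, ?_, skipAt_lt_skipAt.2 this.2.1, ?_⟩
    · simp [skipAt, hqa]
    · simp only [skipAt]; split_ifs <;> omega
  constructor
  · refine fun hL => ⟨fun ⟨p, hp, q, hq, e, l, r⟩ => hL ?_, ?_⟩
    · by_cases hqa : q.1 = a
      · exact hopen q hq hqa
      · refine ⟨_, skipAt_mem_insertArc.2 hp, _, skipAt_mem_insertArc.2 hq, ?_,
          skipAt_lt_skipAt.2 l, skipAt_lt_skipAt.2 r⟩
        simp only [skipAt]; split_ifs <;> omega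
    · rw [Finset.mem_insert, Finset.mem_image]
      by_contra! hc
      obtain ⟨q, hq, hqa⟩ := (h.2.1 a).1 (by omega)
      rcases hqa with hqa | hqa
      · exact hL (hopen q hq hqa.symm)
      · exact hc.2 q hq hqa.symm
  · rintro ⟨hL, ha⟩ ⟨p, hp, q, hq, e, l, r⟩
    rcases mem_insertArc.1 hq with rfl | ⟨q, hqX, rfl⟩
    · have := (((isMatching_insertArc_iff h1 h2).2 h).bounds hp).2.2
      simp only at r
      omega
    rcases mem_insertArc.1 hp with rfl | ⟨p, hpX, rfl⟩
    · have hqa : q.1 = a := by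
        simp only [skipAt] at e; split_ifs at e <;> omega
      have hb := h.bounds hqX
      rw [Finset.mem_insert, Finset.mem_image] at ha
      rcases ha with rfl | ⟨p, hp, hpa⟩
      · omega
      · by_cases hpq : p = q
        · subst hpq; omega
        · exact (h.2.2 p hp q hqX hpq).2.2.1 (hpa.trans hqa.symm)
    · refine hL ⟨p, hpX, q, hqX, ?_, skipAt_lt_skipAt.1 l, skipAt_lt_skipAt.1 r⟩
      have := skipAt_lt_skipAt.1 (l.trans r)
      simp only [skipAt] at e; split_ifs at e <;> omega

lemma IsMatching.exists_insertArc_eq {n : ℕ} {Z : Finset (ℕ × ℕ)} (h : IsMatching (n + 1) Z) :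
    ∃ X a, 1 ≤ a ∧ a ≤ 2 * n + 1 ∧ insertArc n X a = Z := by
  obtain ⟨z, hz, hzn⟩ := (h.2.1 (2 * n + 2)).1 (by omega)
  have hb := h.bounds hz
  obtain ⟨a, b⟩ := z
  simp only at hzn hb
  obtain rfl : b = 2 * n + 2 := by omega
  refine ⟨Z.preimage (Prod.map (skipAt a) (skipAt a))
    ((skipAt_injective a).prodMap (skipAt_injective a)).injOn, a, hb.1, by omega, ?_⟩
  ext q
  simp only [mem_insertArc, Finset.mem_preimage, Prod.map]
  constructor
  · rintro (rfl | ⟨p, hp, rfl⟩)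
    · exact hz
    · exact hp
  · intro hq
    by_cases hqz : q = (a, 2 * n + 2)
    · exact Or.inl hqz
    · have hne := h.2.2 q hq _ hz hqz
      obtain ⟨i, hi⟩ := exists_skipAt_eq hne.1
      obtain ⟨j, hj⟩ := exists_skipAt_eq hne.2.2.1
      have hij : (skipAt a i, skipAt a j) = q := Prod.ext hi hj
      exact Or.inr ⟨(i, j), hij ▸ hq, hij⟩

lemma insertArc_inj {n a a' : ℕ} {X X' : Finset (ℕ × ℕ)}
    (hm : IsMatching (n + 1) (insertArc n X a)) (h : insertArc n X a = insertArc n X' a') :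
    X = X' ∧ a = a' := by
  have haa : a = a' := by
    by_contra hne
    exact (hm.2.2 (a, 2 * n + 2) (mem_insertArc.2 (Or.inl rfl)) (a', 2 * n + 2)
      (h ▸ mem_insertArc.2 (Or.inl rfl)) (fun e => hne (Prod.ext_iff.1 e).1)).2.2.2 rfl
  subst haa
  refine ⟨?_, rfl⟩
  ext p
  rw [← skipAt_mem_insertArc (n := n) (a := a), h, skipAt_mem_insertArc]

lemma finite_setOf_isMatching_not_hasLeftNesting (n : ℕ) :
    {X : Finset (ℕ × ℕ) | IsMatching n X ∧ ¬ HasLeftNesting X}.Finite := by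
  refine (Finset.finite_toSet
    (Finset.Icc 1 (2 * n) ×ˢ Finset.Icc 1 (2 * n)).powerset).subset fun X hX => ?_
  rw [Finset.mem_coe, Finset.mem_powerset]
  intro p hp
  have := hX.1.bounds hp
  simp only [Finset.mem_product, Finset.mem_Icc]
  omega

/-- The number of matchings on `[2n]` with no left-nestings is exactly `n!`. -/
theorem matchings_no_left_nesting_card_eq_factorial (n : ℕ) :
    {X : Finset (ℕ × ℕ) | IsMatching n X ∧ ¬ HasLeftNesting X}.ncard = Nat.factorial n := by
  induction n with
  | zero =>
    rw [Nat.factorial_zero, Set.ncard_eq_one]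
    refine ⟨∅, Set.eq_singleton_iff_unique_mem.2 ⟨⟨⟨by simp, ?_, by simp⟩, ?_⟩, ?_⟩⟩
    · intro i; simp; omega
    · simp [HasLeftNesting]
    · exact fun X hX => Finset.card_eq_zero.1 hX.1.card_eq
  | succ n ih =>
    have hfin := finite_setOf_isMatching_not_hasLeftNesting
    rw [Set.ncard_eq_toFinset_card _ (hfin n)] at ih
    rw [Set.ncard_eq_toFinset_card _ (hfin (n + 1)), Nat.factorial_succ, ← ih, mul_comm]
    have hbound : ∀ {X a}, IsMatching n X → a ∈ insert (2 * n + 1) (X.image Prod.snd) →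
        1 ≤ a ∧ a ≤ 2 * n + 1 := by
      intro X a hX ha
      rw [Finset.mem_insert, Finset.mem_image] at ha
      rcases ha with rfl | ⟨p, hp, rfl⟩
      · omega
      · have := hX.bounds hp; omega
    have hcard : ((hfin n).toFinset.sigma
        fun X => insert (2 * n + 1) (X.image Prod.snd)).card = (hfin n).toFinset.card * (n + 1) := by
      rw [Finset.card_sigma, Finset.sum_const_nat]
      intro X hX
      have hX := ((hfin n).mem_toFinset.1 hX).1
      rw [Finset.card_insert_of_notMem, hX.card_closers]
      rw [Finset.mem_image]
      rintro ⟨p, hp, hpn⟩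
      have := hX.bounds hp; omega
    rw [← hcard]
    symm
    refine Finset.card_bij (fun s _ => insertArc n s.1 s.2) ?_ ?_ ?_
    · rintro ⟨X, a⟩ hs
      rw [Finset.mem_sigma, Set.Finite.mem_toFinset] at hs
      obtain ⟨⟨hX, hL⟩, ha⟩ := hs
      have hb := hbound hX ha
      exact (hfin _).mem_toFinset.2 ⟨(isMatching_insertArc_iff hb.1 hb.2).2 hX,
        (not_hasLeftNesting_insertArc_iff hX hb.1 hb.2).2 ⟨hL, ha⟩⟩
    · rintro ⟨X, a⟩ hs ⟨X', a'⟩ _ e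
      rw [Finset.mem_sigma, Set.Finite.mem_toFinset] at hs
      have hb := hbound hs.1.1 hs.2
      obtain ⟨rfl, rfl⟩ := insertArc_inj ((isMatching_insertArc_iff hb.1 hb.2).2 hs.1.1) e
      rfl
    · intro Z hZ
      obtain ⟨hZ, hL⟩ := (hfin _).mem_toFinset.1 hZ
      obtain ⟨X, a, h1, h2, rfl⟩ := hZ.exists_insertArc_eq
      have hX := (isMatching_insertArc_iff h1 h2).1 hZ
      have hXa := (not_hasLeftNesting_insertArc_iff hX h1 h2).1 hL
      exact ⟨⟨X, a⟩, Finset.mem_sigma.2 ⟨(hfin n).mem_toFinset.2 ⟨hX, hXa.1⟩, hXa.2⟩, rfl⟩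
end

section
/- For every natural number n, the map φ is a bijection from the set of matchings on [2n] with no left-nestings onto the set of inversion tables of length n. -/
/-- The left endpoint of the arc of `X` whose right endpoint is `r`
(junk if there is no such arc). -/
def leftOf (X : Finset (ℕ × ℕ)) (r : ℕ) : ℕ :=
  (X.filter (fun p => p.2 = r)).sup Prod.fst

/-- The map `φ`: numbering the arcs of `X` in increasing order of their right endpoints,
`φ(X) i` is the number of right endpoints of `X` smaller than the left endpoint of the
`i`-th arc (arcs indexed by `Fin n`, i.e. 0-based). -/
def phi (n : ℕ) (X : Finset (ℕ × ℕ)) : Fin n → ℕ := fun i =>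
  ((X.image Prod.snd).filter
    (fun r => r < leftOf X (((X.image Prod.snd).sort (· ≤ ·)).getD i.1 0))).card

/-- The number of indices whose value under `f` is at most `f i`. -/
def rank {ι : Type*} [Fintype ι] (f : ι → ℕ) (i : ι) : ℕ :=
  (Finset.univ.filter fun j => f j ≤ f i).card

theorem rank_lt_rank_of_lt {ι : Type*} [Fintype ι] {f : ι → ℕ} {i j : ι} (h : f i < f j) :
    rank f i < rank f j := by
  apply Finset.card_lt_card
  rw [Finset.ssubset_iff_of_subset]
  · exact ⟨j, by simp, by simpa using h⟩
  · intro k hk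
    simp only [Finset.mem_filter, Finset.mem_univ, true_and] at hk ⊢
    omega

theorem rank_lt_rank_iff {ι : Type*} [Fintype ι] {f : ι → ℕ} {i j : ι} :
    rank f i < rank f j ↔ f i < f j := by
  refine ⟨fun h => ?_, rank_lt_rank_of_lt⟩
  by_contra! hji
  refine absurd h (not_lt.2 (Finset.card_le_card fun k hk => ?_))
  simp only [Finset.mem_filter, Finset.mem_univ, true_and] at hk ⊢
  omega

theorem rank_injective {ι : Type*} [Fintype ι] {f : ι → ℕ} (hf : Function.Injective f) :
    Function.Injective (rank f) := by
  intro i j h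
  apply hf
  have h₁ := (rank_lt_rank_iff (f := f) (i := i) (j := j)).not.1 (by omega)
  have h₂ := (rank_lt_rank_iff (f := f) (i := j) (j := i)).not.1 (by omega)
  omega

theorem image_rank {ι : Type*} [Fintype ι] {f : ι → ℕ} (hf : Function.Injective f) :
    Finset.univ.image (rank f) = Finset.Icc 1 (Fintype.card ι) := by
  apply Finset.eq_of_subset_of_card_le
  · intro x hx
    obtain ⟨i, -, rfl⟩ := Finset.mem_image.1 hx
    exact Finset.mem_Icc.2 ⟨Finset.card_pos.2 ⟨i, by simp⟩, Finset.card_le_univ _⟩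
  · rw [Finset.card_image_of_injective _ (rank_injective hf)]
    simp

theorem rank_eq_self {ι : Type*} [Fintype ι] {f : ι → ℕ} (hf : Function.Injective f)
    (him : Finset.univ.image f = Finset.Icc 1 (Fintype.card ι)) : rank f = f := by
  funext i
  have hi : f i ∈ Finset.Icc 1 (Fintype.card ι) := him ▸ Finset.mem_image_of_mem f (by simp)
  have h : (Finset.univ.filter fun j => f j ≤ f i).image f = Finset.Icc 1 (f i) := by
    ext x
    simp only [Finset.mem_image, Finset.mem_filter, Finset.mem_univ, true_and, Finset.mem_Icc]
    constructor
    · rintro ⟨j, hj, rfl⟩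
      have : f j ∈ Finset.Icc 1 (Fintype.card ι) := him ▸ Finset.mem_image_of_mem f (by simp)
      exact ⟨(Finset.mem_Icc.1 this).1, hj⟩
    · rintro ⟨h₁, h₂⟩
      have : x ∈ Finset.univ.image f := by
        rw [him, Finset.mem_Icc]
        exact ⟨h₁, h₂.trans (Finset.mem_Icc.1 hi).2⟩
      obtain ⟨j, -, rfl⟩ := Finset.mem_image.1 this
      exact ⟨j, h₂, rfl⟩
  rw [rank, ← Finset.card_image_of_injective _ hf, h]
  simp

theorem rank_congr {ι : Type*} [Fintype ι] {f g : ι → ℕ} (hf : Function.Injective f)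
    (h : ∀ i j, f i < f j → g i < g j) : rank f = rank g := by
  funext i
  refine congrArg Finset.card (Finset.filter_congr fun j _ => ⟨fun hji => ?_, fun hji => ?_⟩)
  · rcases hji.lt_or_eq with hlt | heq
    · exact (h j i hlt).le
    · rw [hf heq]
  · by_contra! hlt
    exact absurd (h i j hlt) (not_lt.2 hji)

theorem lt_card_filter_lt_iff {n : ℕ} {r : Fin n → ℕ} (hr : StrictMono r) (x : ℕ) (k : Fin n) :
    k.1 < (Finset.univ.filter fun j => r j < x).card ↔ r k < x := by
  constructor
  · intro h
    by_contra! hx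
    have : (Finset.univ.filter fun j => r j < x) ⊆ Finset.Iio k := by
      intro j hj
      simp only [Finset.mem_filter, Finset.mem_univ, true_and] at hj
      exact Finset.mem_Iio.2 (hr.lt_iff_lt.1 (hj.trans_le hx))
    have := Finset.card_le_card this
    rw [Fin.card_Iio] at this
    omega
  · intro h
    have : Finset.Iic k ⊆ Finset.univ.filter fun j => r j < x := by
      intro j hj
      simp only [Finset.mem_filter, Finset.mem_univ, true_and]
      exact (hr.monotone (Finset.mem_Iic.1 hj)).trans_lt h
    have := Finset.card_le_card this
    rw [Fin.card_Iic] at this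
    omega

/-- The set of arcs `(l i, r i)`. -/
def arcs {n : ℕ} (l r : Fin n → ℕ) : Finset (ℕ × ℕ) :=
  Finset.univ.image fun i => (l i, r i)

theorem mem_arcs {n : ℕ} {l r : Fin n → ℕ} {p : ℕ × ℕ} :
    p ∈ arcs l r ↔ ∃ i, (l i, r i) = p := by
  simp [arcs]

theorem phi_arcs {n : ℕ} {l r : Fin n → ℕ} (hr : StrictMono r) (i : Fin n) :
    phi n (arcs l r) i = (Finset.univ.filter fun k => r k < l i).card := by
  have hR : (arcs l r).image Prod.snd = Finset.univ.image r := by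
    simp [arcs, Finset.image_image, Function.comp_def]
  have hcard : (Finset.univ.image r).card = n := by
    rw [Finset.card_image_of_injective _ hr.injective]
    simp
  have hsort : ((Finset.univ.image r).sort (· ≤ ·)).getD i.1 0 = r i := by
    have h := Finset.orderEmbOfFin_unique hcard (f := r) (fun x => by simp) hr
    have hi : i.1 < ((Finset.univ.image r).sort (· ≤ ·)).length := by simp [hcard]
    rw [List.getD_eq_getElem _ _ hi, congrFun h i]
    simp [Finset.orderEmbOfFin_apply]
  have hleft : leftOf (arcs l r) (r i) = l i := by
    have : (arcs l r).filter (fun p => p.2 = r i) = {(l i, r i)} := by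
      ext p
      simp only [Finset.mem_filter, mem_arcs, Finset.mem_singleton]
      constructor
      · rintro ⟨⟨j, rfl⟩, hj⟩
        rw [hr.injective hj]
      · rintro rfl
        exact ⟨⟨i, rfl⟩, rfl⟩
    simp [leftOf, this]
  rw [phi, hR, hsort, hleft, Finset.filter_image, Finset.card_image_of_injective _ hr.injective]

theorem isMatching_arcs {n : ℕ} {l r : Fin n → ℕ} (hlr : ∀ i, l i < r i)
    (hinj : Function.Injective (Sum.elim l r))
    (him : Finset.univ.image (Sum.elim l r) = Finset.Icc 1 (2 * n)) :
    IsMatching n (arcs l r) := by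
  refine ⟨?_, fun x => ?_, ?_⟩
  · intro p hp
    obtain ⟨i, rfl⟩ := mem_arcs.1 hp
    exact hlr i
  · rw [← Finset.mem_Icc, ← him]
    simp only [Finset.mem_image, Finset.mem_univ, true_and, mem_arcs]
    constructor
    · rintro ⟨i | i, rfl⟩
      · exact ⟨_, ⟨i, rfl⟩, Or.inl rfl⟩
      · exact ⟨_, ⟨i, rfl⟩, Or.inr rfl⟩
    · rintro ⟨_, ⟨i, rfl⟩, h | h⟩
      · exact ⟨Sum.inl i, h.symm⟩
      · exact ⟨Sum.inr i, h.symm⟩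
  · intro p hp q hq hpq
    obtain ⟨i, rfl⟩ := mem_arcs.1 hp
    obtain ⟨j, rfl⟩ := mem_arcs.1 hq
    have hij : i ≠ j := fun h => hpq (h ▸ rfl)
    exact ⟨hinj.ne (a₁ := Sum.inl i) (a₂ := Sum.inl j) (by simpa using hij),
      hinj.ne (a₁ := Sum.inl i) (a₂ := Sum.inr j) (by simp),
      hinj.ne (a₁ := Sum.inr i) (a₂ := Sum.inl j) (by simp),
      hinj.ne (a₁ := Sum.inr i) (a₂ := Sum.inr j) (by simpa using hij)⟩

theorem IsMatching.exists_arcs {n : ℕ} {X : Finset (ℕ × ℕ)} (hX : IsMatching n X) :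
    ∃ l r : Fin n → ℕ, X = arcs l r ∧ StrictMono r ∧ (∀ i, l i < r i) ∧
      Function.Injective (Sum.elim l r) ∧
      Finset.univ.image (Sum.elim l r) = Finset.Icc 1 (2 * n) := by
  obtain ⟨hlt, hcov, hdisj⟩ := hX
  have hne : ∀ p ∈ X, ∀ q ∈ X, p.1 ≠ q.2 := by
    intro p hp q hq h
    by_cases hpq : p = q
    · subst hpq
      exact (hlt p hp).ne h
    · exact (hdisj p hp q hq hpq).2.1 h
  have hfst : Set.InjOn Prod.fst (X : Set (ℕ × ℕ)) := fun p hp q hq h =>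
    by_contra fun hpq => (hdisj p hp q hq hpq).1 h
  have hsnd : Set.InjOn Prod.snd (X : Set (ℕ × ℕ)) := fun p hp q hq h =>
    by_contra fun hpq => (hdisj p hp q hq hpq).2.2.2 h
  have hunion : X.image Prod.fst ∪ X.image Prod.snd = Finset.Icc 1 (2 * n) := by
    ext x
    rw [Finset.mem_Icc, hcov]
    simp only [Finset.mem_union, Finset.mem_image]
    constructor
    · rintro (⟨p, hp, rfl⟩ | ⟨p, hp, rfl⟩)
      · exact ⟨p, hp, Or.inl rfl⟩
      · exact ⟨p, hp, Or.inr rfl⟩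
    · rintro ⟨p, hp, h | h⟩
      · exact Or.inl ⟨p, hp, h.symm⟩
      · exact Or.inr ⟨p, hp, h.symm⟩
  have hcard : (X.image Prod.snd).card = n := by
    have hd : Disjoint (X.image Prod.fst) (X.image Prod.snd) := by
      rw [Finset.disjoint_left]
      intro x hx hx'
      obtain ⟨p, hp, rfl⟩ := Finset.mem_image.1 hx
      obtain ⟨q, hq, h⟩ := Finset.mem_image.1 hx'
      exact hne p hp q hq h.symm
    have h := Finset.card_union_of_disjoint hd
    rw [hunion, Nat.card_Icc, Finset.card_image_of_injOn hfst,
      Finset.card_image_of_injOn hsnd] at h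
    rw [Finset.card_image_of_injOn hsnd]
    omega
  let r : Fin n ↪o ℕ := (X.image Prod.snd).orderEmbOfFin hcard
  have hr : ∀ i, ∃ x, (x, r i) ∈ X := by
    intro i
    obtain ⟨⟨x, y⟩, hp, h⟩ := Finset.mem_image.1 (Finset.orderEmbOfFin_mem _ hcard i)
    have h : y = r i := h
    exact ⟨x, h ▸ hp⟩
  choose l hl using hr
  have hX : X = arcs l r := by
    ext p
    rw [mem_arcs]
    constructor
    · intro hp
      have hp₂ : p.2 ∈ Set.range r := by
        rw [Finset.range_orderEmbOfFin]
        exact Finset.mem_coe.2 (Finset.mem_image_of_mem _ hp)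
      obtain ⟨i, hi⟩ := hp₂
      exact ⟨i, hsnd (hl i) hp hi⟩
    · rintro ⟨i, rfl⟩
      exact hl i
  refine ⟨l, r, hX, r.strictMono, fun i => hlt _ (hl i), ?_, ?_⟩
  · refine Function.Injective.sumElim (fun i j h => ?_) r.injective
      fun i j => hne _ (hl i) _ (hl j)
    have := hfst (hl i) (hl j) h
    exact r.injective (congrArg Prod.snd this)
  · rw [← hunion, hX]
    ext x
    simp [mem_arcs, Finset.mem_image, Prod.ext_iff]

/-- An integer encoding the place, in the matching with inversion table `a`, of the left endpoint
(`Sum.inl i`) and of the right endpoint (`Sum.inr i`) of the `i`-th arc. -/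
def key {n : ℕ} (a : Fin n → ℕ) : Fin n ⊕ Fin n → ℕ :=
  Sum.elim (fun i => a i * (n + 1) + i) (fun i => i * (n + 1) + n)

theorem mul_add_lt_mul_add_iff {m x y u v : ℕ} (hu : u < m) (hv : v < m) :
    x * m + u < y * m + v ↔ x < y ∨ x = y ∧ u < v := by
  rcases lt_trichotomy x y with h | rfl | h
  · have := Nat.mul_le_mul_right m h
    rw [Nat.succ_mul] at this
    exact iff_of_true (by omega) (Or.inl h)
  · simp
  · have := Nat.mul_le_mul_right m h
    rw [Nat.succ_mul] at this
    exact iff_of_false (by omega) (by omega)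

theorem key_inl_lt_inl {n : ℕ} {a : Fin n → ℕ} {i j : Fin n} :
    key a (Sum.inl i) < key a (Sum.inl j) ↔ a i < a j ∨ a i = a j ∧ i < j :=
  mul_add_lt_mul_add_iff (by omega) (by omega)

theorem key_inl_lt_inr {n : ℕ} {a : Fin n → ℕ} {i j : Fin n} :
    key a (Sum.inl i) < key a (Sum.inr j) ↔ a i ≤ j := by
  refine (mul_add_lt_mul_add_iff (by omega) (by omega)).trans ?_
  omega

theorem key_inr_lt_inl {n : ℕ} {a : Fin n → ℕ} {i j : Fin n} :
    key a (Sum.inr i) < key a (Sum.inl j) ↔ i < a j := by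
  refine (mul_add_lt_mul_add_iff (by omega) (by omega)).trans ?_
  omega

theorem key_inr_lt_inr {n : ℕ} {a : Fin n → ℕ} {i j : Fin n} :
    key a (Sum.inr i) < key a (Sum.inr j) ↔ i < j := by
  refine (mul_add_lt_mul_add_iff (by omega) (by omega)).trans ?_
  omega

theorem key_injective {n : ℕ} (a : Fin n → ℕ) : Function.Injective (key a) := by
  rintro (i | i) (j | j) h
  · have h₁ := key_inl_lt_inl.not.1 h.not_lt
    have h₂ := key_inl_lt_inl.not.1 h.not_gt
    exact congrArg Sum.inl (by omega)
  · have h₁ := key_inl_lt_inr.not.1 h.not_lt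
    have h₂ := key_inr_lt_inl.not.1 h.not_gt
    omega
  · have h₁ := key_inr_lt_inl.not.1 h.not_lt
    have h₂ := key_inl_lt_inr.not.1 h.not_gt
    omega
  · have h₁ := key_inr_lt_inr.not.1 h.not_lt
    have h₂ := key_inr_lt_inr.not.1 h.not_gt
    exact congrArg Sum.inr (by omega)

theorem right_lt_right_of_no_right_between {n : ℕ} {l r : Fin n → ℕ}
    (hlr : ∀ i, l i < r i) (hinj : Function.Injective (Sum.elim l r))
    (him : Finset.univ.image (Sum.elim l r) = Finset.Icc 1 (2 * n))
    (hnest : ¬ HasLeftNesting (arcs l r)) {i j : Fin n} (hij : l i < l j)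
    (hbetween : ∀ k, l i < r k → l j ≤ r k) : r i < r j := by
  induction hd : l j - l i using Nat.strong_induction_on generalizing i with
  | _ d ih =>
    have hl : l j ∈ Finset.Icc 1 (2 * n) := by
      rw [← him]
      exact Finset.mem_image.2 ⟨Sum.inl j, by simp, rfl⟩
    have hmem : l i + 1 ∈ Finset.univ.image (Sum.elim l r) := by
      rw [him, Finset.mem_Icc]
      rw [Finset.mem_Icc] at hl
      omega
    obtain ⟨m | k, -, hm⟩ := Finset.mem_image.1 hmem
    · simp only [Sum.elim_inl] at hm
      have hne : r i ≠ r m := fun h => by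
        have := hinj (a₁ := Sum.inr i) (a₂ := Sum.inr m) h
        simp only [Sum.inr.injEq] at this
        subst this
        omega
      have him' : r i < r m := by
        by_contra! hle
        exact hnest ⟨_, mem_arcs.2 ⟨i, rfl⟩, _, mem_arcs.2 ⟨m, rfl⟩, hm, hlr m,
          lt_of_le_of_ne hle hne.symm⟩
      by_cases hmj : m = j
      · exact hmj ▸ him'
      · have hlne : l m ≠ l j := fun h =>
          hmj (Sum.inl_injective (hinj (a₁ := Sum.inl m) (a₂ := Sum.inl j) h))
        exact him'.trans (ih (l j - l m) (by omega) (by omega)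
          (fun k hk => hbetween k (by omega)) rfl)
    · simp only [Sum.elim_inr] at hm
      have h := hbetween k (by omega)
      have hne : l j ≠ r k := fun h => by
        have := hinj (a₁ := Sum.inl j) (a₂ := Sum.inr k) h
        simp at this
      omega

theorem rank_key_phi_arcs {n : ℕ} {l r : Fin n → ℕ} (hr : StrictMono r)
    (hlr : ∀ i, l i < r i) (hinj : Function.Injective (Sum.elim l r))
    (him : Finset.univ.image (Sum.elim l r) = Finset.Icc 1 (2 * n))
    (hnest : ¬ HasLeftNesting (arcs l r)) :
    rank (key (phi n (arcs l r))) = Sum.elim l r := by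
  have hphi : ∀ i k : Fin n, k.1 < phi n (arcs l r) i ↔ r k < l i := fun i k => by
    rw [phi_arcs hr, lt_card_filter_lt_iff hr]
  have hne : ∀ i k, l i ≠ r k := fun i k h => by
    have := hinj (a₁ := Sum.inl i) (a₂ := Sum.inr k) h
    simp at this
  rw [← rank_eq_self hinj (by rw [him, Fintype.card_sum, Fintype.card_fin, two_mul])]
  refine rank_congr (key_injective _) ?_
  rintro (i | i) (j | j) h <;> simp only [Sum.elim_inl, Sum.elim_inr]
  · rcases key_inl_lt_inl.1 h with h | ⟨h, hij⟩
    · have hi : phi n (arcs l r) i < n := by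
        refine h.trans_le ?_
        rw [phi_arcs hr]
        exact (Finset.card_le_univ _).trans (by simp)
      have h₁ := (hphi i ⟨_, hi⟩).not.1 (lt_irrefl _)
      have h₂ := (hphi j ⟨_, hi⟩).1 h
      omega
    · by_contra! hle
      have hlne : l i ≠ l j := fun h =>
        hij.ne (Sum.inl_injective (hinj (a₁ := Sum.inl i) (a₂ := Sum.inl j) h))
      refine absurd (right_lt_right_of_no_right_between hlr hinj him hnest
        (lt_of_le_of_ne hle hlne.symm) fun k hk => ?_) (hr hij).not_gt
      rw [← not_lt, ← hphi, h, hphi]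
      omega
  · have h := (hphi i j).not.1 (not_lt.2 (key_inl_lt_inr.1 h))
    have := hne i j
    omega
  · exact (hphi j i).1 (key_inr_lt_inl.1 h)
  · exact hr (key_inr_lt_inr.1 h)

theorem phi_le {n : ℕ} {X : Finset (ℕ × ℕ)} (hX : IsMatching n X) (i : Fin n) :
    phi n X i ≤ i := by
  obtain ⟨l, r, rfl, hr, hlr, -, -⟩ := hX.exists_arcs
  rw [phi_arcs hr, ← not_lt, lt_card_filter_lt_iff hr, not_lt]
  exact (hlr i).le

theorem phi_injOn (n : ℕ) :
    Set.InjOn (phi n) {X : Finset (ℕ × ℕ) | IsMatching n X ∧ ¬ HasLeftNesting X} := by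
  rintro X ⟨hX, hXn⟩ Y ⟨hY, hYn⟩ h
  obtain ⟨l, r, rfl, hr, hlr, hinj, him⟩ := hX.exists_arcs
  obtain ⟨l', r', rfl, hr', hlr', hinj', him'⟩ := hY.exists_arcs
  have := rank_key_phi_arcs hr hlr hinj him hXn
  rw [h, rank_key_phi_arcs hr' hlr' hinj' him' hYn] at this
  have hl : l' = l := funext fun i => congrFun this (Sum.inl i)
  have hr : r' = r := funext fun i => congrFun this (Sum.inr i)
  rw [hl, hr]

theorem exists_phi_eq {n : ℕ} {a : Fin n → ℕ} (ha : ∀ i, a i ≤ i.1) :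
    ∃ X, (IsMatching n X ∧ ¬ HasLeftNesting X) ∧ phi n X = a := by
  let l : Fin n → ℕ := fun i => rank (key a) (Sum.inl i)
  let r : Fin n → ℕ := fun i => rank (key a) (Sum.inr i)
  have helim : Sum.elim l r = rank (key a) := by
    funext x
    cases x <;> rfl
  have hr : StrictMono r := fun i j hij => rank_lt_rank_iff.2 (key_inr_lt_inr.2 hij)
  refine ⟨arcs l r, ⟨isMatching_arcs (fun i => rank_lt_rank_iff.2 (key_inl_lt_inr.2 (ha i)))
    ?_ ?_, ?_⟩, ?_⟩
  · rw [helim]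
    exact rank_injective (key_injective a)
  · rw [helim, image_rank (key_injective a), Fintype.card_sum, Fintype.card_fin, two_mul]
  · rintro ⟨p, hp, q, hq, hpq, -, hlt⟩
    obtain ⟨i, rfl⟩ := mem_arcs.1 hp
    obtain ⟨j, rfl⟩ := mem_arcs.1 hq
    have hji : j < i := hr.lt_iff_lt.1 hlt
    have hl : l i < l j := by
      simp only at hpq
      omega
    have haij : a i < a j := by
      have := key_inl_lt_inl.1 (rank_lt_rank_iff.1 hl)
      omega
    have h₁ : l i < r ⟨a i, (ha i).trans_lt i.2⟩ :=
      rank_lt_rank_iff.2 (key_inl_lt_inr.2 le_rfl)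
    have h₂ : r ⟨a i, (ha i).trans_lt i.2⟩ < l j :=
      rank_lt_rank_iff.2 (key_inr_lt_inl.2 haij)
    simp only at hpq
    omega
  · funext i
    have : (Finset.univ.filter fun k => r k < l i) =
        Finset.Iio (⟨a i, (ha i).trans_lt i.2⟩ : Fin n) := by
      ext k
      simp only [Finset.mem_filter, Finset.mem_univ, true_and, Finset.mem_Iio, Fin.lt_def]
      exact rank_lt_rank_iff.trans key_inr_lt_inl
    rw [phi_arcs hr, this, Fin.card_Iio]

/-- `φ` is a bijection from the set of matchings on `[2n]` with no left-nestings onto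
the set of inversion tables of length `n` (sequences `a_1 … a_n` with `0 ≤ a_i ≤ i - 1`,
here indexed 0-based: `a i ≤ i`). -/
theorem phi_bijOn_inversion_tables (n : ℕ) :
    Set.BijOn (phi n) {X : Finset (ℕ × ℕ) | IsMatching n X ∧ ¬ HasLeftNesting X}
      {a : Fin n → ℕ | ∀ i, a i ≤ i.1} := by
  refine ⟨fun X hX i => phi_le hX.1 i, phi_injOn n, fun a ha => ?_⟩
  exact exists_phi_eq ha
end

section
/- For every natural number n, the map φ restricts to a bijection between the set of matchings on [2n] with no 2-nestings and the set T_n of inversion tables of length n with no decreasing subsequence of consecutive integers. In particular, the number of matchings on [2n] with no 2-nestings equals |T_n|. -/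
/-- A 2-nesting: pairs `(a, b), (c, d) ∈ X` with `a < c < d < b` and `c - a ≤ 2`. -/
def Has2Nesting (X : Finset (ℕ × ℕ)) : Prop :=
  ∃ p ∈ X, ∃ q ∈ X, p.1 < q.1 ∧ q.1 ≤ p.1 + 2 ∧ q.1 < q.2 ∧ q.2 < p.2

/-- `l` and `r` enumerate the left and right endpoints of a matching on `[2n]`,
in increasing order of the right endpoints. -/
structure IsArcEnum {n : ℕ} (l r : Fin n → ℕ) : Prop where
  strictMono : StrictMono r
  lt : ∀ i, l i < r i
  injective : Function.Injective l
  ne : ∀ i j, l i ≠ r j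
  mem_iff : ∀ x : ℕ, (1 ≤ x ∧ x ≤ 2 * n) ↔ ∃ i, x = l i ∨ x = r i

/-- The right endpoint of the `i`-th arc of the matching with inversion table `a`. -/
def closer {n : ℕ} (a : Fin n → ℕ) (i : Fin n) : ℕ :=
  i + 1 + (Finset.univ.filter fun k => a k ≤ i).card

/-- The left endpoint of the `i`-th arc of the matching without left-nestings
with inversion table `a`. -/
def opener {n : ℕ} (a : Fin n → ℕ) (i : Fin n) : ℕ :=
  a i + 1 + (Finset.univ.filter fun k => a k < a i ∨ a k = a i ∧ k < i).card

theorem IsMatching.exists_arcEnum {n : ℕ} {X : Finset (ℕ × ℕ)} (hX : IsMatching n X) :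
    ∃ l r : Fin n → ℕ, IsArcEnum l r ∧ X = arcs l r := by
  obtain ⟨hlt, hcov, hdis⟩ := hX
  have hfst : Set.InjOn Prod.fst (X : Set (ℕ × ℕ)) := fun p hp q hq h => by
    by_contra hne
    exact (hdis p hp q hq hne).1 h
  have hsnd : Set.InjOn Prod.snd (X : Set (ℕ × ℕ)) := fun p hp q hq h => by
    by_contra hne
    exact (hdis p hp q hq hne).2.2.2 h
  have hne : ∀ p ∈ X, ∀ q ∈ X, p.1 ≠ q.2 := fun p hp q hq => by
    by_cases h : p = q
    · subst h
      exact (hlt p hp).ne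
    · exact (hdis p hp q hq h).2.1
  have hunion : X.image Prod.fst ∪ X.image Prod.snd = Finset.Icc 1 (2 * n) := by
    ext x
    rw [Finset.mem_Icc, hcov x]
    simp only [Finset.mem_union, Finset.mem_image]
    grind
  have hdisj : Disjoint (X.image Prod.fst) (X.image Prod.snd) := by
    rw [Finset.disjoint_left]
    intro x hx hx'
    obtain ⟨p, hp, rfl⟩ := Finset.mem_image.1 hx
    obtain ⟨q, hq, h⟩ := Finset.mem_image.1 hx'
    exact hne p hp q hq h.symm
  have hcard : (X.image Prod.snd).card = n := by
    have h := congrArg Finset.card hunion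
    rw [Finset.card_union_of_disjoint hdisj, Finset.card_image_of_injOn hfst,
      Finset.card_image_of_injOn hsnd, Nat.card_Icc] at h
    rw [Finset.card_image_of_injOn hsnd]
    omega
  set r : Fin n → ℕ := fun i => (X.image Prod.snd).orderEmbOfFin hcard i
  have hex : ∀ i, ∃ p ∈ X, p.2 = r i := fun i =>
    Finset.mem_image.1 (Finset.orderEmbOfFin_mem _ hcard i)
  have hsurj : ∀ p ∈ X, ∃ i, r i = p.2 := fun p hp => by
    have : p.2 ∈ Set.range r := by
      change p.2 ∈ Set.range ((X.image Prod.snd).orderEmbOfFin hcard)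
      rw [Finset.range_orderEmbOfFin]
      exact Finset.mem_coe.2 (Finset.mem_image_of_mem _ hp)
    exact this
  choose f hf hfr using hex
  have hmono : StrictMono r := ((X.image Prod.snd).orderEmbOfFin hcard).strictMono
  have hXf : ∀ p ∈ X, ∃ i, f i = p := fun p hp => by
    obtain ⟨i, hi⟩ := hsurj p hp
    exact ⟨i, hsnd (hf i) hp ((hfr i).trans hi)⟩
  refine ⟨fun i => (f i).1, r, ⟨hmono, fun i => ?_, fun i j h => ?_, fun i j => ?_, fun x => ?_⟩, ?_⟩
  · rw [← hfr i]
    exact hlt _ (hf i)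
  · apply hmono.injective
    rw [← hfr i, ← hfr j, hfst (hf i) (hf j) h]
  · rw [← hfr j]
    exact hne _ (hf i) _ (hf j)
  · rw [hcov x]
    constructor
    · rintro ⟨p, hp, h⟩
      obtain ⟨i, rfl⟩ := hXf p hp
      exact ⟨i, by rwa [← hfr i]⟩
    · rintro ⟨i, h⟩
      exact ⟨f i, hf i, by rwa [hfr i]⟩
  · ext p
    rw [mem_arcs]
    constructor
    · intro hp
      obtain ⟨i, rfl⟩ := hXf p hp
      exact ⟨i, by rw [← hfr i]⟩
    · rintro ⟨i, rfl⟩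
      rw [← hfr i]
      exact hf i

namespace IsArcEnum

variable {n : ℕ} {l r : Fin n → ℕ}

theorem isMatching (h : IsArcEnum l r) : IsMatching n (arcs l r) := by
  refine ⟨fun p hp => ?_, fun x => ?_, fun p hp q hq hpq => ?_⟩
  · obtain ⟨i, rfl⟩ := mem_arcs.1 hp
    exact h.lt i
  · rw [h.mem_iff x]
    constructor
    · rintro ⟨i, hi⟩
      exact ⟨_, mem_arcs.2 ⟨i, rfl⟩, hi⟩
    · rintro ⟨p, hp, hx⟩
      obtain ⟨i, rfl⟩ := mem_arcs.1 hp
      exact ⟨i, hx⟩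
  · obtain ⟨i, rfl⟩ := mem_arcs.1 hp
    obtain ⟨j, rfl⟩ := mem_arcs.1 hq
    have hij : i ≠ j := fun e => hpq (by rw [e])
    exact ⟨fun e => hij (h.injective e), h.ne i j, (h.ne j i).symm,
      fun e => hij (h.strictMono.injective e)⟩

theorem eq_card_add_card (h : IsArcEnum l r) {x : ℕ} (hx : 1 ≤ x) (hx' : x ≤ 2 * n) :
    x = 1 + (Finset.univ.filter fun k => l k < x).card +
      (Finset.univ.filter fun k => r k < x).card := by
  have hunion : ((Finset.univ.filter fun k => l k < x).image l) ∪
      ((Finset.univ.filter fun k => r k < x).image r) = Finset.Ico 1 x := by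
    ext y
    have hy := h.mem_iff y
    simp only [Finset.mem_union, Finset.mem_image, Finset.mem_filter, Finset.mem_univ,
      true_and, Finset.mem_Ico]
    constructor
    · rintro (⟨k, hk, rfl⟩ | ⟨k, hk, rfl⟩)
      · exact ⟨(hy.2 ⟨k, Or.inl rfl⟩).1, hk⟩
      · exact ⟨(hy.2 ⟨k, Or.inr rfl⟩).1, hk⟩
    · rintro ⟨h1, h2⟩
      obtain ⟨k, rfl | rfl⟩ := hy.1 ⟨h1, by omega⟩
      · exact Or.inl ⟨k, h2, rfl⟩
      · exact Or.inr ⟨k, h2, rfl⟩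
  have hdisj : Disjoint ((Finset.univ.filter fun k => l k < x).image l)
      ((Finset.univ.filter fun k => r k < x).image r) := by
    rw [Finset.disjoint_left]
    intro y hy hy'
    obtain ⟨i, _, rfl⟩ := Finset.mem_image.1 hy
    obtain ⟨j, _, hj⟩ := Finset.mem_image.1 hy'
    exact h.ne i j hj.symm
  have hc := congrArg Finset.card hunion
  rw [Finset.card_union_of_disjoint hdisj, Finset.card_image_of_injective _ h.injective,
    Finset.card_image_of_injective _ h.strictMono.injective, Nat.card_Ico] at hc
  omega

theorem right_lt_left_iff (h : IsArcEnum l r) (i j : Fin n) :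
    r j < l i ↔ j.1 < phi n (arcs l r) i := by
  rw [phi_arcs h.strictMono]
  constructor
  · intro hj
    have hsub : Finset.Iic j ⊆ Finset.univ.filter fun k => r k < l i := fun k hk => by
      simpa using (h.strictMono.monotone (Finset.mem_Iic.1 hk)).trans_lt hj
    have := Finset.card_le_card hsub
    rw [Fin.card_Iic] at this
    omega
  · intro hj
    by_contra hle
    have hsub : (Finset.univ.filter fun k => r k < l i) ⊆ Finset.Iio j := fun k hk => by
      rw [Finset.mem_Iio]
      by_contra hjk
      exact hle ((h.strictMono.monotone (not_lt.1 hjk)).trans_lt (Finset.mem_filter.1 hk).2)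
    have := Finset.card_le_card hsub
    rw [Fin.card_Iio] at this
    omega

theorem phi_le (h : IsArcEnum l r) (i : Fin n) : phi n (arcs l r) i ≤ i := by
  have h1 := h.right_lt_left_iff i i
  have h2 := h.lt i
  omega

theorem right_eq_closer (h : IsArcEnum l r) (i : Fin n) :
    r i = closer (phi n (arcs l r)) i := by
  have hb := (h.mem_iff (r i)).2 ⟨i, Or.inr rfl⟩
  have hx := h.eq_card_add_card hb.1 hb.2
  have h1 : (Finset.univ.filter fun k => r k < r i) = Finset.Iio i := by
    ext k
    simp [h.strictMono.lt_iff_lt]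
  have h2 : (Finset.univ.filter fun k => l k < r i) =
      Finset.univ.filter fun k => phi n (arcs l r) k ≤ i := by
    refine Finset.filter_congr fun k _ => ?_
    have := h.right_lt_left_iff k i
    have := h.ne k i
    omega
  rw [h1, h2, Fin.card_Iio] at hx
  rw [closer]
  omega

theorem left_lt_left_of_phi_lt (h : IsArcEnum l r) {i k : Fin n}
    (hk : phi n (arcs l r) k < phi n (arcs l r) i) : l k < l i := by
  let j : Fin n := ⟨phi n (arcs l r) k, (h.phi_le k).trans_lt k.2⟩
  have h1 := h.right_lt_left_iff k j
  have h2 := h.right_lt_left_iff i j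
  have h3 : j.1 = phi n (arcs l r) k := rfl
  omega

theorem lt_of_left_lt_left (h : IsArcEnum l r) (hX : ¬ Has2Nesting (arcs l r)) {i k : Fin n}
    (ha : phi n (arcs l r) i = phi n (arcs l r) k) (hlt : l i < l k) : i < k := by
  obtain ⟨d, hd⟩ := Nat.exists_eq_add_of_lt hlt
  induction d generalizing k with
  | zero =>
    by_contra hik
    have hki : k < i := lt_of_le_of_ne (not_lt.1 hik) (by rintro rfl; omega)
    exact hX ⟨_, mem_arcs.2 ⟨i, rfl⟩, _, mem_arcs.2 ⟨k, rfl⟩, hlt, by simp only; omega,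
      h.lt k, h.strictMono hki⟩
  | succ d ih =>
    have hb := (h.mem_iff (l i)).2 ⟨i, Or.inl rfl⟩
    have hb' := (h.mem_iff (l k)).2 ⟨k, Or.inl rfl⟩
    obtain ⟨m, hm | hm⟩ := (h.mem_iff (l i + d + 1)).1 ⟨by omega, by omega⟩
    · have h1 : ¬ phi n (arcs l r) m < phi n (arcs l r) i := fun hlt' => by
        have := h.left_lt_left_of_phi_lt hlt'
        omega
      have h2 : ¬ phi n (arcs l r) k < phi n (arcs l r) m := fun hlt' => by
        have := h.left_lt_left_of_phi_lt hlt'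
        omega
      refine (ih (k := m) (by omega) (by omega) hm.symm).trans ?_
      by_contra hmk
      have hkm : k < m := lt_of_le_of_ne (not_lt.1 hmk) (by rintro rfl; omega)
      exact hX ⟨_, mem_arcs.2 ⟨m, rfl⟩, _, mem_arcs.2 ⟨k, rfl⟩, by simp only; omega,
        by simp only; omega, h.lt k, h.strictMono hkm⟩
    · have h1 := h.right_lt_left_iff k m
      have h2 := h.right_lt_left_iff i m
      omega

theorem left_eq_opener (h : IsArcEnum l r) (hX : ¬ Has2Nesting (arcs l r)) (i : Fin n) :
    l i = opener (phi n (arcs l r)) i := by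
  have hb := (h.mem_iff (l i)).2 ⟨i, Or.inl rfl⟩
  have hx := h.eq_card_add_card hb.1 hb.2
  have h2 : (Finset.univ.filter fun k => l k < l i) =
      Finset.univ.filter fun k => phi n (arcs l r) k < phi n (arcs l r) i ∨
        phi n (arcs l r) k = phi n (arcs l r) i ∧ k < i := by
    refine Finset.filter_congr fun k _ => ⟨fun hk => ?_, ?_⟩
    · rcases lt_trichotomy (phi n (arcs l r) k) (phi n (arcs l r) i) with hlt | heq | hgt
      · exact Or.inl hlt
      · exact Or.inr ⟨heq, h.lt_of_left_lt_left hX heq hk⟩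
      · have := h.left_lt_left_of_phi_lt hgt
        omega
    · rintro (hlt | ⟨heq, hki⟩)
      · exact h.left_lt_left_of_phi_lt hlt
      · rcases lt_trichotomy (l k) (l i) with hl | hl | hl
        · exact hl
        · exact absurd (h.injective hl) hki.ne
        · exact absurd (h.lt_of_left_lt_left hX heq.symm hl) hki.asymm
  rw [h2, ← phi_arcs h.strictMono] at hx
  rw [opener]
  omega

theorem phi_ne_phi_add_one (h : IsArcEnum l r) (hX : ¬ Has2Nesting (arcs l r)) {p q : Fin n}
    (hpq : p < q) : phi n (arcs l r) p ≠ phi n (arcs l r) q + 1 := by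
  intro ha
  have hl := h.left_eq_opener hX
  set a := phi n (arcs l r)
  obtain ⟨p', hp', hpmin⟩ := Finset.exists_min_image (Finset.univ.filter fun k => a k = a p) id
    ⟨p, by simp⟩
  obtain ⟨q', hq', hqmax⟩ := Finset.exists_max_image (Finset.univ.filter fun k => a k = a q) id
    ⟨q, by simp⟩
  simp only [Finset.mem_filter, Finset.mem_univ, true_and, id] at hp' hq' hpmin hqmax
  have h1 : (Finset.univ.filter fun k => a k < a p' ∨ a k = a p' ∧ k < p') =
      insert q' (Finset.univ.filter fun k => a k < a q' ∨ a k = a q' ∧ k < q') := by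
    ext k
    have h1 := hpmin k
    have h2 := hqmax k
    have h3 : k = q' → a k = a q' := fun e => e ▸ rfl
    simp only [Finset.mem_filter, Finset.mem_univ, true_and, Finset.mem_insert]
    grind
  have hcard := congrArg Finset.card h1
  rw [Finset.card_insert_of_notMem (by simp)] at hcard
  have e1 := hl p'
  have e2 := hl q'
  rw [opener] at e1 e2
  have hlt : p' < q' := (hpmin p rfl).trans_lt (hpq.trans_le (hqmax q rfl))
  exact hX ⟨_, mem_arcs.2 ⟨q', rfl⟩, _, mem_arcs.2 ⟨p', rfl⟩, by simp only; omega,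
    by simp only; omega, h.lt p', h.strictMono hlt⟩

end IsArcEnum

section InversionTable

variable {n : ℕ} {a : Fin n → ℕ}

theorem closer_lt_opener_iff (i k : Fin n) : closer a k < opener a i ↔ k.1 < a i := by
  rw [closer, opener]
  constructor
  · intro hlt
    by_contra hk
    have hsub : (Finset.univ.filter fun m => a m < a i ∨ a m = a i ∧ m < i) ⊆
        Finset.univ.filter fun m => a m ≤ k := fun m hm => by
      simp only [Finset.mem_filter, Finset.mem_univ, true_and] at hm ⊢
      omega
    have := Finset.card_le_card hsub
    omega
  · intro hk
    have hsub : (Finset.univ.filter fun m => a m ≤ k) ⊆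
        Finset.univ.filter fun m => a m < a i ∨ a m = a i ∧ m < i := fun m hm => by
      simp only [Finset.mem_filter, Finset.mem_univ, true_and] at hm ⊢
      omega
    have := Finset.card_le_card hsub
    omega

theorem opener_ne_closer (i k : Fin n) : opener a i ≠ closer a k := by
  intro h
  have hk := (closer_lt_opener_iff (a := a) i k).not.1 h.not_gt
  have hsub : (Finset.univ.filter fun m => a m < a i ∨ a m = a i ∧ m < i) ⊂
      Finset.univ.filter fun m => a m ≤ k := by
    rw [Finset.ssubset_iff_of_subset]
    · exact ⟨i, by simpa using hk, by simp⟩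
    · intro m hm
      simp only [Finset.mem_filter, Finset.mem_univ, true_and] at hm ⊢
      omega
  have := Finset.card_lt_card hsub
  rw [opener, closer] at h
  omega

theorem closer_strictMono : StrictMono (closer a) := by
  intro i j hij
  have hsub : (Finset.univ.filter fun m => a m ≤ i) ⊆ Finset.univ.filter fun m => a m ≤ j :=
    Finset.monotone_filter_right _ fun m _ hm => by omega
  have := Finset.card_le_card hsub
  rw [closer, closer]
  omega

/-- Openers increase lexicographically, and are at least one step apart
plus one for each closer in between. -/
theorem opener_add_lt_opener {i k : Fin n} (h : a k < a i ∨ a k = a i ∧ k < i) :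
    opener a k + (a i - a k) < opener a i := by
  have hsub : (Finset.univ.filter fun m => a m < a k ∨ a m = a k ∧ m < k) ⊂
      Finset.univ.filter fun m => a m < a i ∨ a m = a i ∧ m < i := by
    rw [Finset.ssubset_iff_of_subset]
    · exact ⟨k, by simpa using h, by simp⟩
    · intro m hm
      simp only [Finset.mem_filter, Finset.mem_univ, true_and] at hm ⊢
      omega
  have := Finset.card_lt_card hsub
  rw [opener, opener]
  omega

theorem opener_injective : Function.Injective (opener a) := by
  intro i k h
  by_contra hik
  have h1 := opener_add_lt_opener (a := a) (i := i) (k := k)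
  have h2 := opener_add_lt_opener (a := a) (i := k) (k := i)
  omega

theorem isArcEnum_opener_closer (ha : ∀ i, a i ≤ i) : IsArcEnum (opener a) (closer a) := by
  have hlt : ∀ i, opener a i < closer a i := fun i =>
    lt_of_le_of_ne (not_lt.1 ((closer_lt_opener_iff i i).not.2 (ha i).not_gt))
      (opener_ne_closer i i)
  have hle : ∀ i, closer a i ≤ 2 * n := fun i => by
    have h := (Finset.univ.filter fun k => a k ≤ i).card_le_univ
    rw [Fintype.card_fin] at h
    rw [closer]
    omega
  have hpos : ∀ i, 1 ≤ opener a i := fun i => by rw [opener]; omega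
  have hdisj : Disjoint (Finset.univ.image (opener a)) (Finset.univ.image (closer a)) := by
    rw [Finset.disjoint_left]
    intro y hy hy'
    obtain ⟨i, _, rfl⟩ := Finset.mem_image.1 hy
    obtain ⟨j, _, hj⟩ := Finset.mem_image.1 hy'
    exact opener_ne_closer i j hj.symm
  have hunion : Finset.univ.image (opener a) ∪ Finset.univ.image (closer a) =
      Finset.Icc 1 (2 * n) := by
    apply Finset.eq_of_subset_of_card_le
    · intro y hy
      simp only [Finset.mem_union, Finset.mem_image, Finset.mem_univ, true_and] at hy
      rw [Finset.mem_Icc]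
      obtain ⟨i, rfl⟩ | ⟨i, rfl⟩ := hy
      · exact ⟨hpos i, (hlt i).le.trans (hle i)⟩
      · exact ⟨(hpos i).trans (hlt i).le, hle i⟩
    · rw [Finset.card_union_of_disjoint hdisj, Finset.card_image_of_injective _ opener_injective,
        Finset.card_image_of_injective _ closer_strictMono.injective, Nat.card_Icc,
        Finset.card_univ, Fintype.card_fin]
      omega
  refine ⟨closer_strictMono, hlt, opener_injective, opener_ne_closer, fun x => ?_⟩
  rw [← Finset.mem_Icc, ← hunion]
  simp only [Finset.mem_union, Finset.mem_image, Finset.mem_univ, true_and, exists_or, eq_comm]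

theorem phi_arcs_opener_closer (ha : ∀ i, a i ≤ i) :
    phi n (arcs (opener a) (closer a)) = a := by
  funext i
  rw [phi_arcs closer_strictMono]
  simp only [closer_lt_opener_iff]
  have : (Finset.univ.filter fun k : Fin n => k.1 < a i) =
      Finset.Iio ⟨a i, (ha i).trans_lt i.2⟩ := by
    ext k
    simp [Fin.lt_def]
  rw [this, Fin.card_Iio]

theorem not_has2Nesting_arcs_opener_closer (h : ¬ ∃ p q : Fin n, p < q ∧ a p = a q + 1) :
    ¬ Has2Nesting (arcs (opener a) (closer a)) := by
  rintro ⟨p, hp, q, hq, h1, h2, -, h4⟩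
  obtain ⟨i, rfl⟩ := mem_arcs.1 hp
  obtain ⟨j, rfl⟩ := mem_arcs.1 hq
  simp only at h1 h2 h4
  have hji : j < i := closer_strictMono.lt_iff_lt.1 h4
  have hne : a j ≠ a i + 1 := fun e => h ⟨j, i, hji, e⟩
  have e1 := opener_add_lt_opener (a := a) (i := i) (k := j)
  have e2 := opener_add_lt_opener (a := a) (i := j) (k := i)
  omega

end InversionTable

/-- `φ` restricts to a bijection between matchings on `[2n]` with no 2-nestings and
the set `T_n` of inversion tables of length `n` with no decreasing subsequence of
consecutive integers; in particular the two sets have the same cardinality. -/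
theorem phi_bijOn_Tn (n : ℕ) :
    Set.BijOn (phi n) {X : Finset (ℕ × ℕ) | IsMatching n X ∧ ¬ Has2Nesting X}
      {a : Fin n → ℕ | (∀ i, a i ≤ i.1) ∧
        ¬ ∃ p q : Fin n, p < q ∧ a p = a q + 1} ∧
    {X : Finset (ℕ × ℕ) | IsMatching n X ∧ ¬ Has2Nesting X}.ncard =
      {a : Fin n → ℕ | (∀ i, a i ≤ i.1) ∧
        ¬ ∃ p q : Fin n, p < q ∧ a p = a q + 1}.ncard := by
  have hbij : Set.BijOn (phi n) {X : Finset (ℕ × ℕ) | IsMatching n X ∧ ¬ Has2Nesting X}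
      {a : Fin n → ℕ | (∀ i, a i ≤ i.1) ∧ ¬ ∃ p q : Fin n, p < q ∧ a p = a q + 1} := by
    refine ⟨?_, ?_, ?_⟩
    · rintro X ⟨hX, hX2⟩
      obtain ⟨l, r, h, rfl⟩ := hX.exists_arcEnum
      exact ⟨h.phi_le, fun ⟨p, q, hpq, e⟩ => h.phi_ne_phi_add_one hX2 hpq e⟩
    · rintro X ⟨hX, hX2⟩ Y ⟨hY, hY2⟩ hXY
      obtain ⟨l, r, h, rfl⟩ := hX.exists_arcEnum
      obtain ⟨l', r', h', rfl⟩ := hY.exists_arcEnum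
      have hl : l = l' := funext fun i => by
        rw [h.left_eq_opener hX2, hXY, ← h'.left_eq_opener hY2]
      have hr : r = r' := funext fun i => by
        rw [h.right_eq_closer, hXY, ← h'.right_eq_closer]
      rw [hl, hr]
    · rintro a ⟨ha, ha'⟩
      exact ⟨arcs (opener a) (closer a), ⟨(isArcEnum_opener_closer ha).isMatching,
        not_has2Nesting_arcs_opener_closer ha'⟩, phi_arcs_opener_closer ha⟩
  refine ⟨hbij, ?_⟩
  rw [← hbij.image_eq, hbij.injOn.ncard_image]
end

section
/- For every n ≥ 1, the cardinality of T_n equals the coefficient of t^n in the integer polynomial 1 + Σ_{m=1}^{n} ∏_{i=1}^{m} (1 - (1-t)^i); that is, |T_n| is the n-th Fishburn number. -/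
open Polynomial

/-- The truncated Fishburn generating polynomial
`1 + Σ_{m=1}^{n} ∏_{i=1}^{m} (1 - (1 - t)^i)` in `ℤ[t]`.
Since `∏_{i=1}^{m}(1-(1-t)^i)` is divisible by `t^m`, truncating the infinite sum
at `m = n` does not affect the coefficient of `t^n`. -/
noncomputable def fishburnPoly (n : ℕ) : Polynomial ℤ :=
  1 + ∑ m ∈ Finset.Icc 1 n, ∏ i ∈ Finset.Icc 1 m, (1 - (1 - Polynomial.X) ^ i)

namespace Fishburn

section Series

variable {R : Type*} [CommRing R]

/-- The geometric sums `p + p² + ⋯ + p^k`. -/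
def geomSum (p : R) : ℕ → R
  | 0 => 0
  | k + 1 => p * (geomSum p k + 1)

/-- The product `∏_{i=1}^{k} (t · (p + ⋯ + p^i))²`. -/
def weight (t p : R) (k : ℕ) : R := ∏ i ∈ Finset.range k, (t * geomSum p (i + 1)) ^ 2

/-- Truncated generating function of partially filled tables with `f` free places,
`l` of which may carry the largest entry. -/
def tableSeries (t p : R) (K f l : ℕ) : R :=
  ∑ k ∈ Finset.range K, weight t p k *
    (geomSum p k ^ f + t * (geomSum p k ^ (f - l) * geomSum p (k + 1) ^ (l + 1)))

/-- Variant of `tableSeries` for the tables in which the largest entry occurs. -/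
def topSeries (t p : R) (K f l : ℕ) : R :=
  ∑ k ∈ Finset.range K, weight t p k *
    (geomSum p k ^ (f - l) * geomSum p (k + 1) ^ l - geomSum p k ^ f)

/-- The product `∏_{i=1}^{n} (z - q^i)`. -/
def shiftedProd (q z : R) (n : ℕ) : R := ∏ i ∈ Finset.range n, (z - q ^ (i + 1))

/-- The partial sum `∑_{n<N} ∏_{i=1}^{n} (z - q^i)`. -/
def shiftedSum (q z : R) (N : ℕ) : R := ∑ n ∈ Finset.range N, shiftedProd q z n

lemma weight_succ (t p : R) (k : ℕ) :
    weight t p (k + 1) = weight t p k * (t * geomSum p (k + 1)) ^ 2 :=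
  Finset.prod_range_succ _ _

lemma pow_dvd_weight (t p : R) (k : ℕ) : t ^ (2 * k) ∣ weight t p k := by
  induction k with
  | zero => simp
  | succ k ih =>
    rw [weight_succ, mul_pow, mul_add, pow_add]
    exact mul_dvd_mul ih (Dvd.intro _ rfl)

lemma topSeries_zero (t p : R) (K f : ℕ) : topSeries t p K f 0 = 0 := by
  simp [topSeries]

lemma topSeries_succ {t p : R} (hp : (1 - t) * p = 1) (K : ℕ) {f l : ℕ} (h : l ≤ f) :
    topSeries t p K (f + 1) (l + 1) =
      topSeries t p K (f + 1) l + (tableSeries t p K f l + topSeries t p K f l) := by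
  obtain ⟨d, rfl⟩ := Nat.exists_eq_add_of_le h
  simp only [topSeries, tableSeries, ← Finset.sum_add_distrib]
  refine Finset.sum_congr rfl fun k _ => ?_
  have e1 : l + d + 1 - (l + 1) = d := by omega
  have e2 : l + d + 1 - l = d + 1 := by omega
  have e3 : l + d - l = d := by omega
  rw [e1, e2, e3]
  have key : geomSum p (k + 1) = geomSum p k + 1 + t * geomSum p (k + 1) := by
    simp only [geomSum]
    linear_combination (geomSum p k + 1) * hp
  linear_combination weight t p k * geomSum p k ^ d * geomSum p (k + 1) ^ l * key

lemma tableSeries_add (t p : R) (K : ℕ) {f l : ℕ} (h : l ≤ f) :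
    tableSeries t p K f l + weight t p K * geomSum p K ^ f =
      0 ^ f + t * (tableSeries t p K (f + 1) (f + 1) + topSeries t p K (f + 1) (l + 1)) := by
  induction K with
  | zero => simp [tableSeries, topSeries, weight, geomSum]
  | succ K ih =>
    simp only [tableSeries, topSeries, Finset.sum_range_succ, weight_succ] at ih ⊢
    have e1 : f + 1 - (l + 1) = f - l := by omega
    rw [e1] at ih ⊢
    simp only [Nat.sub_self, pow_zero, one_mul] at ih ⊢
    linear_combination ih

lemma mul_geomSum {t p : R} (hp : (1 - t) * p = 1) (k : ℕ) : t * geomSum p k = p ^ k - 1 := by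
  induction k with
  | zero => simp [geomSum]
  | succ k ih =>
    simp only [geomSum]
    linear_combination p * ih - hp

lemma shiftedProd_succ (q z : R) (n : ℕ) :
    shiftedProd q z (n + 1) = shiftedProd q z n * (z - q ^ (n + 1)) :=
  Finset.prod_range_succ _ _

lemma shiftedProd_mul {q p : R} (hp : q * p = 1) (z : R) (n : ℕ) :
    p ^ n * shiftedProd q z (n + 1) = (z - q) * shiftedProd q (z * p) n := by
  induction n with
  | zero => simp [shiftedProd]
  | succ n ih =>
    rw [shiftedProd_succ, shiftedProd_succ q (z * p)]
    linear_combination p * (z - q ^ (n + 1 + 1)) * ih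
      - (z - q) * shiftedProd q (z * p) n * q ^ (n + 1) * hp

lemma shiftedSum_succ {q p : R} (hp : q * p = 1) (z : R) (N : ℕ) :
    shiftedSum q z (N + 1) + p ^ (N + 1) * shiftedProd q z (N + 1) =
      z * p + (1 - z * p) ^ 2 * shiftedSum q (z * p) N := by
  induction N with
  | zero =>
    simp [shiftedSum, shiftedProd]
    linear_combination -hp
  | succ N ih =>
    have h := shiftedProd_mul hp z N
    have hq : q ^ (N + 2) * p ^ (N + 2) = 1 := by rw [← mul_pow, hp, one_pow]
    have e : (1 - z * p) ^ 2 = p ^ 2 * (z - q) ^ 2 := by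
      linear_combination (-q * p - 1 + 2 * z * p) * hp
    have hs (w : R) (m : ℕ) : shiftedSum q w (m + 1) = shiftedSum q w m + shiftedProd q w m :=
      Finset.sum_range_succ _ _
    rw [hs z (N + 1), hs (z * p) N, shiftedProd_succ q z (N + 1)]
    linear_combination ih - shiftedProd q z (N + 1) * hq - shiftedProd q (z * p) N * e
      + p ^ 2 * (z - q) * h + p ^ (N + 1) * shiftedProd q z (N + 1) * hp

lemma pow_dvd_shiftedProd {t p : R} (hp : (1 - t) * p = 1) (k n : ℕ) :
    t ^ n ∣ shiftedProd (1 - t) (p ^ k) n := by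
  induction n with
  | zero => simp
  | succ n ih =>
    rw [shiftedProd_succ, pow_succ]
    refine mul_dvd_mul ih ?_
    have h1 : t ∣ p ^ k - 1 := ⟨_, (mul_geomSum hp k).symm⟩
    have h2 : t ∣ 1 - (1 - t) ^ (n + 1) := by
      have := sub_dvd_pow_sub_pow (1 : R) (1 - t) (n + 1)
      simpa using this
    have := dvd_add h1 h2
    simpa using this

lemma dvd_shiftedSum_sub {t p : R} (hp : (1 - t) * p = 1) (K j : ℕ) (h : j ≤ K) :
    t ^ K ∣ shiftedSum (1 - t) 1 K -
      (tableSeries t p j 0 0 + weight t p j * shiftedSum (1 - t) (p ^ j) (K - j)) := by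
  induction j with
  | zero => simp [tableSeries, weight]
  | succ j ih =>
    obtain ⟨N, rfl⟩ := Nat.exists_eq_add_of_le h
    have e1 : j + 1 + N - (j + 1) = N := by omega
    have e2 : j + 1 + N - j = N + 1 := by omega
    specialize ih (by omega)
    rw [e2] at ih
    rw [e1]
    have h1 := shiftedSum_succ hp (p ^ j) N
    have h2 : t ^ (j + 1 + N) ∣
        weight t p j * (p ^ (N + 1) * shiftedProd (1 - t) (p ^ j) (N + 1)) := by
      refine (pow_dvd_pow t (by omega : j + 1 + N ≤ 2 * j + (N + 1))).trans ?_
      rw [pow_add]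
      exact mul_dvd_mul (pow_dvd_weight t p j)
        (Dvd.dvd.mul_left (pow_dvd_shiftedProd hp j (N + 1)) _)
    have h3 := mul_geomSum hp (j + 1)
    have h4 := dvd_sub ih h2
    convert h4 using 1
    rw [← pow_succ] at h1
    simp only [tableSeries, Finset.sum_range_succ, weight_succ, h3]
    simp only [Nat.sub_self, pow_zero, zero_add, pow_one, one_mul, h3]
    linear_combination weight t p j * h1

end Series

section Tables

/-- A set is finite, with the given number of elements. -/
def HasCard {α : Type*} (s : Set α) (z : ℤ) : Prop := s.Finite ∧ (s.ncard : ℤ) = z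

lemma HasCard.union {α : Type*} {s t : Set α} {x y : ℤ} (hs : HasCard s x) (ht : HasCard t y)
    (h : Disjoint s t) : HasCard (s ∪ t) (x + y) :=
  ⟨hs.1.union ht.1, by rw [Set.ncard_union_eq h hs.1 ht.1, Nat.cast_add, hs.2, ht.2]⟩

lemma HasCard.of_bijOn {α β : Type*} {s : Set α} {t : Set β} {x : ℤ} {f : α → β}
    (ht : HasCard t x) (h : Set.BijOn f s t) : HasCard s x := by
  have hs : s.Finite := h.finite_iff_finite.2 ht.1
  refine ⟨hs, ?_⟩
  rw [← ht.2, ← h.image_eq, h.injOn.ncard_image]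

/-- Fillings of the places `0, …, n - 1` and those in `P`: the entry at place `i < n` is at most
`i`, and no entry exceeds a later one by exactly one. -/
def IsFilling (n : ℕ) (P : Finset ℕ) (a : ℕ → ℕ) : Prop :=
  (∀ i, n ≤ i → i ∉ P → a i = 0) ∧ (∀ i < n, a i ≤ i) ∧
    ∀ p q, (p < n ∨ p ∈ P) → (q < n ∨ q ∈ P) → p < q → a p ≠ a q + 1

/-- Fillings with entries less than `n`, where places in `P` outside `Q` avoid `n - 1`. -/
def tables (n : ℕ) (P Q : Finset ℕ) : Set (ℕ → ℕ) :=
  {a | IsFilling n P a ∧ (∀ i ∈ P, a i < n) ∧ ∀ i ∈ P, a i + 1 = n → i ∈ Q}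

/-- Fillings with largest entry `n`, which occurs only in `Q`. -/
def topTables (n : ℕ) (P Q : Finset ℕ) : Set (ℕ → ℕ) :=
  {a | IsFilling n P a ∧ (∀ i ∈ P, a i ≤ n) ∧ (∀ i ∈ P, a i = n → i ∈ Q) ∧ ∃ i ∈ Q, a i = n}

/-- `Q` is an initial segment of `P`, and all of `P` lies above `n`. -/
def IsInitial (n : ℕ) (P Q : Finset ℕ) : Prop :=
  Q ⊆ P ∧ (∀ i ∈ P, n ≤ i) ∧ ∀ i ∈ Q, ∀ j ∈ P, j < i → j ∈ Q

lemma tables_zero (P Q : Finset ℕ) : HasCard (tables 0 P Q) (0 ^ P.card) := by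
  rcases P.eq_empty_or_nonempty with rfl | ⟨i, hi⟩
  · have : tables 0 ∅ Q = {fun _ => 0} := by
      ext a
      simp only [tables, IsFilling, Set.mem_ofPred_eq, Set.mem_singleton_iff]
      refine ⟨fun h => funext fun i => h.1.1 i (Nat.zero_le _) (by simp), ?_⟩
      rintro rfl
      simp
    rw [this]
    exact ⟨Set.finite_singleton _, by simp⟩
  · have : tables 0 P Q = ∅ := by
      ext a
      simp only [tables, Set.mem_ofPred_eq, Set.mem_empty_iff_false, iff_false]
      exact fun h => absurd (h.2.1 i hi) (by simp)
    have hc : P.card ≠ 0 := Finset.card_ne_zero_of_mem hi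
    rw [this, zero_pow hc]
    exact ⟨Set.finite_empty, by simp⟩

lemma isFilling_succ {n : ℕ} {P : Finset ℕ} {a : ℕ → ℕ} :
    IsFilling (n + 1) P a ↔ IsFilling n (insert n P) a ∧ a n ≤ n := by
  have hd : ∀ i, (i < n + 1 ∨ i ∈ P) ↔ (i < n ∨ i ∈ insert n P) := by
    intro i
    rw [Finset.mem_insert]
    grind
  simp only [IsFilling, hd]
  refine ⟨fun ⟨h1, h2, h3⟩ => ⟨⟨?_, ?_, h3⟩, h2 n (by omega)⟩,
    fun ⟨⟨h1, h2, h3⟩, h4⟩ => ⟨?_, ?_, h3⟩⟩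
  · grind
  · grind
  · grind
  · grind

lemma tables_succ {n : ℕ} {P Q : Finset ℕ} (h : IsInitial (n + 1) P Q) :
    tables (n + 1) P Q =
      tables n (insert n P) (insert n P) ∪ topTables n (insert n P) (insert n Q) := by
  obtain ⟨h1, h2, h3⟩ := h
  ext a
  simp only [tables, topTables, Set.mem_union, Set.mem_ofPred_eq, isFilling_succ]
  constructor
  · rintro ⟨⟨hf, hn⟩, hlt, hQ⟩
    by_cases hx : ∃ i ∈ insert n P, a i = n
    · right
      grind
    · left
      grind
  · grind

lemma disjoint_tables {n : ℕ} {P Q Q' : Finset ℕ} (h : Q' ⊆ P) :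
    Disjoint (tables n P Q) (topTables n P Q') := by
  rw [Set.disjoint_left]
  rintro a ⟨-, ha, -⟩ ⟨-, -, -, i, hi, e⟩
  exact absurd (ha i (h hi)) (by omega)

lemma topTables_empty (n : ℕ) (P : Finset ℕ) : topTables n P ∅ = ∅ := by
  ext a
  simp [topTables]

lemma topTables_insert (n : ℕ) (P Q : Finset ℕ) (r : ℕ) :
    topTables n P (insert r Q) =
      topTables n P Q ∪ {a ∈ topTables n P (insert r Q) | a r = n} := by
  ext a
  simp only [topTables, Set.mem_union, Set.mem_ofPred_eq]
  grind

lemma disjoint_topTables {n : ℕ} {P Q : Finset ℕ} {r : ℕ} (hr : r ∉ Q) (hP : r ∈ P) :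
    Disjoint (topTables n P Q) {a ∈ topTables n P (insert r Q) | a r = n} := by
  rw [Set.disjoint_left]
  rintro a ⟨-, -, h, -⟩ ⟨-, e⟩
  exact hr (h r hP e)

lemma bijOn_update {n : ℕ} {P Q : Finset ℕ} {r : ℕ} (h : IsInitial n P (insert r Q))
    (hr : ∀ x ∈ Q, x < r) :
    Set.BijOn (fun a => Function.update a r 0) {a ∈ topTables n P (insert r Q) | a r = n}
      (tables n (P.erase r) Q ∪ topTables n (P.erase r) Q) := by
  obtain ⟨h1, h2, h3⟩ := h
  have hrP : r ∈ P := h1 (Finset.mem_insert_self r Q)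
  have hnr : n ≤ r := h2 r hrP
  refine ⟨?_, ?_, ?_⟩
  · rintro a ⟨⟨⟨f1, f2, f3⟩, a1, a2, -⟩, ar⟩
    have hf : IsFilling n (P.erase r) (Function.update a r 0) := by
      refine ⟨?_, ?_, ?_⟩
      · intro i hi hiP
        by_cases e : i = r
        · simp [e]
        · simp only [Function.update_of_ne e]
          grind
      · intro i hi
        rw [Function.update_of_ne (by omega)]
        exact f2 i hi
      · intro p q hp hq hpq
        have ep : p ≠ r := by grind
        have eq : q ≠ r := by grind
        rw [Function.update_of_ne ep, Function.update_of_ne eq]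
        grind
    by_cases hx : ∃ i ∈ Q, a i = n
    · right
      refine ⟨hf, ?_, ?_, ?_⟩
      · grind
      · grind
      · obtain ⟨i, hi, e⟩ := hx
        refine ⟨i, hi, ?_⟩
        simp only [Function.update_of_ne (hr i hi).ne, e]
    · left
      refine ⟨hf, ?_, ?_⟩
      · grind
      · intro i hi e
        simp only [Function.update_of_ne (Finset.ne_of_mem_erase hi)] at e
        have := f3 r i (Or.inr hrP) (Or.inr (Finset.mem_of_mem_erase hi))
        grind
  · rintro a ⟨-, ha⟩ b ⟨-, hb⟩ hab
    funext i
    by_cases e : i = r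
    · rw [e, ha, hb]
    · have := congrFun hab i
      simpa [Function.update_of_ne e] using this
  · intro b hb
    have hbf : IsFilling n (P.erase r) b := hb.elim (·.1) (·.1)
    have hble : ∀ i ∈ P.erase r, b i ≤ n :=
      hb.elim (fun h i hi => (h.2.1 i hi).le) (·.2.1)
    have hbQ : ∀ i ∈ P.erase r, b i = n → i ∈ Q :=
      hb.elim (fun h i hi e => absurd (h.2.1 i hi) (by omega)) (·.2.2.1)
    have hlate : ∀ i, (i < n ∨ i ∈ P.erase r) → r < i → b i + 1 ≠ n := by
      intro i hi hri e
      have hiP : i ∈ P.erase r := hi.resolve_left (by omega)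
      rcases hb with hb | ⟨-, -, -, j, hj, ej⟩
      · have := hr i (hb.2.2 i hiP e)
        omega
      · have hjr := hr j hj
        have := hbf.2.2 j i (Or.inr (Finset.mem_erase.2 ⟨hjr.ne, h1 (by simp [hj])⟩)) hi
          (by omega)
        omega
    obtain ⟨f1, f2, f3⟩ := hbf
    refine ⟨Function.update b r n, ⟨⟨⟨?_, ?_, ?_⟩, ?_, ?_, ?_⟩, by simp⟩, ?_⟩
    · intro i hi hiP
      rw [Function.update_of_ne (by grind)]
      grind
    · intro i hi
      rw [Function.update_of_ne (by omega)]
      exact f2 i hi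
    · intro p q hp hq hpq
      by_cases ep : p = r
      · subst ep
        rw [Function.update_self, Function.update_of_ne (by omega)]
        have := hlate q (by grind) hpq
        omega
      · by_cases eq : q = r
        · subst eq
          rw [Function.update_self, Function.update_of_ne ep]
          grind
        · rw [Function.update_of_ne ep, Function.update_of_ne eq]
          grind
    · grind
    · grind
    · exact ⟨r, by simp, by simp⟩
    · have hb0 : b r = 0 := f1 r hnr (by simp)
      funext i
      by_cases e : i = r
      · simp [e, hb0]
      · simp [Function.update_of_ne e]

lemma hasCard_topTables {p : PowerSeries ℤ} (hp : (1 - PowerSeries.X) * p = 1) {n K : ℕ}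
    (ih : ∀ P Q, IsInitial n P Q → HasCard (tables n P Q)
      (PowerSeries.coeff n (tableSeries PowerSeries.X p K P.card Q.card)))
    (P Q : Finset ℕ) (h : IsInitial n P Q) :
    HasCard (topTables n P Q)
      (PowerSeries.coeff n (topSeries PowerSeries.X p K P.card Q.card)) := by
  induction Q using Finset.induction_on_max generalizing P with
  | empty =>
    rw [topTables_empty, Finset.card_empty, topSeries_zero]
    exact ⟨Set.finite_empty, by simp⟩
  | insert r Q hr ihQ =>
    have hrQ : r ∉ Q := fun hh => lt_irrefl _ (hr r hh)
    have hrP : r ∈ P := h.1 (Finset.mem_insert_self r Q)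
    have i1 : IsInitial n P Q := by
      obtain ⟨h1, h2, h3⟩ := h
      refine ⟨by grind, h2, ?_⟩
      intro i hi j hj hji
      have := hr i hi
      have := h3 i (by simp [hi]) j hj hji
      grind
    have i2 : IsInitial n (P.erase r) Q := by
      obtain ⟨h1, h2, h3⟩ := i1
      refine ⟨by grind, by grind, by grind⟩
    have hc := Finset.card_erase_add_one hrP
    have hle : Q.card ≤ (P.erase r).card := Finset.card_le_card i2.1
    rw [Finset.card_insert_of_notMem hrQ, topTables_insert, ← hc,
      topSeries_succ hp K hle, map_add, map_add]
    refine HasCard.union ?_ ?_ (disjoint_topTables hrQ hrP)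
    · rw [hc]
      exact ihQ P i1
    · exact ((ih _ _ i2).union (ihQ _ i2) (disjoint_tables i2.1)).of_bijOn (bijOn_update h hr)

lemma coeff_weight_mul (p g : PowerSeries ℤ) {n K : ℕ} (h : n < 2 * K) :
    PowerSeries.coeff n (weight PowerSeries.X p K * g) = 0 :=
  PowerSeries.X_pow_dvd_iff.1 ((pow_dvd_weight _ p K).mul_right g) n h

theorem hasCard_tables {p : PowerSeries ℤ} (hp : (1 - PowerSeries.X) * p = 1) {n K : ℕ}
    (hK : n < 2 * K) (P Q : Finset ℕ) (h : IsInitial n P Q) :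
    HasCard (tables n P Q)
      (PowerSeries.coeff n (tableSeries PowerSeries.X p K P.card Q.card)) := by
  induction n generalizing P Q with
  | zero =>
    have hc := congrArg (PowerSeries.coeff 0)
      (tableSeries_add (PowerSeries.X : PowerSeries ℤ) p K (Finset.card_le_card h.1))
    have hw := coeff_weight_mul p (geomSum p K ^ P.card) hK
    rw [map_add, hw, add_zero, map_add, PowerSeries.coeff_zero_X_mul, add_zero] at hc
    rw [hc]
    convert tables_zero P Q using 1
    simp
  | succ n ih =>
    have hnP : n ∉ P := fun hh => absurd (h.2.1 n hh) (by omega)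
    have hnQ : n ∉ Q := fun hh => hnP (h.1 hh)
    have hc := congrArg (PowerSeries.coeff (n + 1))
      (tableSeries_add (PowerSeries.X : PowerSeries ℤ) p K (Finset.card_le_card h.1))
    have hw := coeff_weight_mul p (geomSum p K ^ P.card) hK
    have h0 : PowerSeries.coeff (n + 1) ((0 : PowerSeries ℤ) ^ P.card) = 0 := by
      rcases P.card with _ | c <;> simp [PowerSeries.coeff_one]
    rw [map_add, hw, add_zero, map_add, h0, zero_add, PowerSeries.coeff_succ_X_mul, map_add] at hc
    rw [hc, tables_succ h]
    obtain ⟨h1, h2, h3⟩ := h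
    have i1 : IsInitial n (insert n P) (insert n P) := ⟨subset_rfl, by grind, by grind⟩
    have i2 : IsInitial n (insert n P) (insert n Q) := ⟨by grind, by grind, by grind⟩
    have ih' := ih (by omega)
    have c1 := ih' _ _ i1
    have c2 := hasCard_topTables hp ih' _ _ i2
    rw [Finset.card_insert_of_notMem hnP] at c1 c2
    rw [Finset.card_insert_of_notMem hnQ] at c2
    exact c1.union c2 (disjoint_tables i2.1)

/-- Extension of a finite sequence by zero. -/
def extendZero {n : ℕ} (a : Fin n → ℕ) (i : ℕ) : ℕ := if h : i < n then a ⟨i, h⟩ else 0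

lemma extendZero_val {n : ℕ} (a : Fin n → ℕ) (i : Fin n) : extendZero a i = a i := by
  simp [extendZero]

lemma bijOn_extendZero (n : ℕ) :
    Set.BijOn extendZero {a : Fin n → ℕ | (∀ i, a i ≤ i.1) ∧
      ¬ ∃ p q : Fin n, p < q ∧ a p = a q + 1} (tables n ∅ ∅) := by
  refine ⟨?_, ?_, ?_⟩
  · rintro a ⟨h1, h2⟩
    refine ⟨⟨fun i hi _ => ?_, fun i hi => ?_, fun p q hp hq hpq e => ?_⟩, by simp, by simp⟩
    · simp [extendZero, hi]
    · simpa [extendZero, hi] using h1 ⟨i, hi⟩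
    · have hp' : p < n := by simpa using hp
      have hq' : q < n := by simpa using hq
      simp only [extendZero, hp', hq', dif_pos] at e
      exact h2 ⟨⟨p, hp'⟩, ⟨q, hq'⟩, hpq, e⟩
  · intro a _ b _ hab
    funext i
    rw [← extendZero_val a, ← extendZero_val b, hab]
  · rintro b ⟨⟨f1, f2, f3⟩, -, -⟩
    refine ⟨fun i => b i, ⟨fun i => f2 i i.2, ?_⟩, ?_⟩
    · rintro ⟨p, q, hpq, e⟩
      exact f3 p q (Or.inl p.2) (Or.inl q.2) hpq e
    · funext i
      by_cases hi : i < n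
      · simp [extendZero, hi]
      · simp [extendZero, hi, f1 i (by omega)]

lemma coe_fishburnPoly (n : ℕ) :
    ((fishburnPoly n : Polynomial ℤ) : PowerSeries ℤ) =
      shiftedSum (1 - PowerSeries.X) 1 (n + 1) := by
  have h : fishburnPoly n = shiftedSum (1 - X) 1 (n + 1) := by
    rw [fishburnPoly, shiftedSum, Finset.sum_range_succ', add_comm]
    congr 1
    rw [Finset.range_eq_Ico, Finset.sum_Ico_add' (fun m => shiftedProd (1 - X : ℤ[X]) 1 m) 0 n 1,
      zero_add]
    refine Finset.sum_congr rfl fun m _ => ?_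
    rw [shiftedProd, Finset.range_eq_Ico,
      Finset.prod_Ico_add' (fun i => (1 - (1 - X) ^ i : ℤ[X])) 0 m 1, zero_add]
    rfl
  have hX : Polynomial.coeToPowerSeries.ringHom (X : ℤ[X]) = PowerSeries.X := by simp
  rw [h, ← Polynomial.coeToPowerSeries.ringHom_apply]
  simp only [shiftedSum, shiftedProd, map_sum, map_prod, map_sub, map_pow, map_one, hX]

end Tables

end Fishburn

/-- For `n ≥ 1`, the number of inversion tables of length `n` with no decreasing
subsequence of consecutive integers (the set `T_n`, indexed 0-based: `a i ≤ i` and no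
`p < q` with `a p = a q + 1`) is the coefficient of `t^n` in
`1 + Σ_{m=1}^{n} ∏_{i=1}^{m} (1 - (1-t)^i)`, i.e. the `n`-th Fishburn number. -/
theorem Tn_card_eq_fishburn (n : ℕ) (hn : 1 ≤ n) :
    ({a : Fin n → ℕ | (∀ i, a i ≤ i.1) ∧
        ¬ ∃ p q : Fin n, p < q ∧ a p = a q + 1}.ncard : ℤ) =
      (fishburnPoly n).coeff n := by
  obtain ⟨p, hp⟩ : ∃ p : PowerSeries ℤ, (1 - PowerSeries.X) * p = 1 :=
    ⟨PowerSeries.mk 1, by rw [mul_comm]; exact PowerSeries.mk_one_mul_one_sub_eq_one ℤ⟩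
  have hT := (Fishburn.hasCard_tables hp (n := n) (K := n + 1) (by omega) ∅ ∅
    ⟨subset_rfl, by simp, by simp⟩).of_bijOn (Fishburn.bijOn_extendZero n)
  have hd := Fishburn.dvd_shiftedSum_sub hp (n + 1) (n + 1) le_rfl
  have h0 := PowerSeries.X_pow_dvd_iff.1 hd n (by omega)
  rw [Nat.sub_self, Fishburn.shiftedSum, Fishburn.shiftedSum, Finset.sum_range_zero, mul_zero,
    add_zero, ← Fishburn.shiftedSum, map_sub, sub_eq_zero] at h0
  rw [hT.2, ← Polynomial.coeff_coe, Fishburn.coe_fishburnPoly, h0, Finset.card_empty]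
end

section
/- For every n ≥ 1, the number of matchings on [2n] with no 2-nestings equals the coefficient of t^n in the integer polynomial 1 + Σ_{m=1}^{n} ∏_{i=1}^{m} (1 - (1-t)^i), i.e., the n-th Fishburn number. (This resolves a conjecture of Claesson and Linusson.) -/
open Finset PowerSeries

/-! ### Partial matchings -/

/-- `countCompletions b N k j` counts the ways of completing a partial matching to the left when
positions `1, …, N` are still to be filled, `k` closers await their opener, and `j` of these are
allowed for the next opener. The constraint is dropped after two consecutive closers; the flag `b`
records whether one closer has just been read. -/
def countCompletions : Bool → ℕ → ℕ → ℕ → ℕ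
  | _, 0, k, _ => if k = 0 then 1 else 0
  | false, N + 1, k, j =>
      countCompletions true N (k + 1) (j + 1) +
        ∑ i ∈ range j, countCompletions false N (k - 1) i
  | true, N + 1, k, j =>
      countCompletions false N (k + 1) (k + 1) +
        ∑ i ∈ range j, countCompletions false N (k - 1) i

/-- `X` is a matching of `{1, …, N} ∪ S` all of whose openers are at most `N`. -/
def IsPartialMatching (N : ℕ) (S : Finset ℕ) (X : Finset (ℕ × ℕ)) : Prop :=
  (∀ p ∈ X, p.1 < p.2 ∧ p.1 ≤ N) ∧
  (∀ i : ℕ, ((1 ≤ i ∧ i ≤ N) ∨ i ∈ S) ↔ ∃ p ∈ X, i = p.1 ∨ i = p.2) ∧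
  (∀ p ∈ X, ∀ q ∈ X, p ≠ q → p.1 ≠ q.1 ∧ p.1 ≠ q.2 ∧ p.2 ≠ q.1 ∧ p.2 ≠ q.2)

open Classical in
/-- Partial matchings without 2-nestings in which every opener `a` with `l ≤ a + 2` is matched to
a closer smaller than `d`. -/
noncomputable def completions (N : ℕ) (S : Finset ℕ) (l d : ℕ) : Finset (Finset (ℕ × ℕ)) :=
  {X ∈ ((Icc 1 N ∪ S) ×ˢ (Icc 1 N ∪ S)).powerset |
    IsPartialMatching N S X ∧ ¬ Has2Nesting X ∧ ∀ p ∈ X, l ≤ p.1 + 2 → p.2 < d}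

lemma mem_completions {N : ℕ} {S : Finset ℕ} {l d : ℕ} {X : Finset (ℕ × ℕ)} :
    X ∈ completions N S l d ↔
      IsPartialMatching N S X ∧ ¬ Has2Nesting X ∧ ∀ p ∈ X, l ≤ p.1 + 2 → p.2 < d := by
  classical
  simp only [completions, mem_filter, and_iff_right_iff_imp, mem_powerset]
  rintro ⟨⟨-, h, -⟩, -⟩ p hp
  have h1 := (h p.1).2 ⟨p, hp, Or.inl rfl⟩
  have h2 := (h p.2).2 ⟨p, hp, Or.inr rfl⟩
  simp only [mem_product, mem_union, mem_Icc]
  exact ⟨h1, h2⟩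

lemma has2Nesting_mono {X Y : Finset (ℕ × ℕ)} (h : X ⊆ Y) : Has2Nesting X → Has2Nesting Y := by
  rintro ⟨p, hp, q, hq, h'⟩
  exact ⟨p, h hp, q, h hq, h'⟩

lemma IsPartialMatching.erase_opener {N s : ℕ} {S : Finset ℕ} {X : Finset (ℕ × ℕ)}
    (hS : ∀ x ∈ S, N + 1 < x) (h : IsPartialMatching (N + 1) S X) (hs : (N + 1, s) ∈ X) :
    s ∈ S ∧ IsPartialMatching N (S.erase s) (X.erase (N + 1, s)) := by
  obtain ⟨h1, h2, h3⟩ := h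
  have hlt := (h1 _ hs).1
  have hsS : s ∈ S := by
    have := (h2 s).2 ⟨_, hs, Or.inr rfl⟩
    simp only at hlt
    rcases this with h | h
    · omega
    · exact h
  refine ⟨hsS, ?_, ?_, ?_⟩
  · intro p hp
    rw [mem_erase] at hp
    have := h3 p hp.2 _ hs hp.1
    have h1' := h1 p hp.2
    exact ⟨h1'.1, by simp only at this; omega⟩
  · intro i
    constructor
    · intro hi
      have hi' : i ≠ N + 1 ∧ i ≠ s := by
        rw [mem_erase] at hi
        simp only at hlt
        rcases hi with hi | hi
        · omega
        · have := hS i hi.2; exact ⟨by omega, hi.1⟩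
      obtain ⟨p, hp, hpi⟩ := (h2 i).1 (by
        rw [mem_erase] at hi
        rcases hi with hi | hi
        · left; omega
        · exact Or.inr hi.2)
      refine ⟨p, mem_erase.2 ⟨?_, hp⟩, hpi⟩
      rintro rfl
      simp only at hpi
      omega
    · rintro ⟨p, hp, hpi⟩
      rw [mem_erase] at hp
      have h4 := h3 p hp.2 _ hs hp.1
      have h5 := (h2 i).2 ⟨p, hp.2, hpi⟩
      simp only at h4
      rw [mem_erase]
      have : i ≠ N + 1 ∧ i ≠ s := by
        rcases hpi with rfl | rfl <;> tauto
      rcases h5 with h5 | h5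
      · left; omega
      · exact Or.inr ⟨this.2, h5⟩
  · intro p hp q hq
    exact h3 p (mem_of_mem_erase hp) q (mem_of_mem_erase hq)

lemma IsPartialMatching.insert_opener {N s : ℕ} {S : Finset ℕ} {X : Finset (ℕ × ℕ)}
    (hS : ∀ x ∈ S, N + 1 < x) (hs : s ∈ S) (h : IsPartialMatching N (S.erase s) X) :
    IsPartialMatching (N + 1) S (insert (N + 1, s) X) := by
  obtain ⟨h1, h2, h3⟩ := h
  have hsN := hS s hs
  have hfresh : ∀ p ∈ X, p.1 ≠ N + 1 ∧ p.1 ≠ s ∧ p.2 ≠ N + 1 ∧ p.2 ≠ s := by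
    intro p hp
    have ha := (h2 p.1).2 ⟨p, hp, Or.inl rfl⟩
    have hb := (h2 p.2).2 ⟨p, hp, Or.inr rfl⟩
    rw [mem_erase] at ha hb
    have h1' := h1 p hp
    refine ⟨by omega, by omega, ?_, ?_⟩
    · rcases hb with hb | hb
      · omega
      · have := hS _ hb.2; omega
    · rcases hb with hb | hb
      · omega
      · exact hb.1
  refine ⟨?_, ?_, ?_⟩
  · intro p hp
    rcases mem_insert.1 hp with rfl | hp
    · exact ⟨hsN, le_rfl⟩
    · have := h1 p hp; exact ⟨this.1, by omega⟩
  · intro i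
    rw [exists_mem_insert, ← h2 i, mem_erase]
    by_cases his : i = s
    · subst his; simp [hs]
    · simp only [his, ne_eq, not_false_eq_true, true_and, or_false]
      constructor
      · rintro (h | h)
        · by_cases hi : i = N + 1
          · exact Or.inl hi
          · right; left; omega
        · exact Or.inr (Or.inr h)
      · rintro (h | h | h)
        · left; omega
        · left; omega
        · exact Or.inr h
  · intro p hp q hq hpq
    rcases mem_insert.1 hp with rfl | hp <;> rcases mem_insert.1 hq with rfl | hq
    · exact absurd rfl hpq
    · have := hfresh q hq
      simp only
      tauto
    · exact hfresh p hp |>.imp id fun h => ⟨h.1, h.2.1, h.2.2⟩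
    · exact h3 p hp q hq hpq

lemma isPartialMatching_insert_iff {N : ℕ} {S : Finset ℕ} {X : Finset (ℕ × ℕ)} :
    IsPartialMatching N (insert (N + 1) S) X ↔
      IsPartialMatching (N + 1) S X ∧ ∀ p ∈ X, p.1 ≠ N + 1 := by
  have key : ∀ i, ((1 ≤ i ∧ i ≤ N) ∨ i ∈ insert (N + 1) S) ↔ ((1 ≤ i ∧ i ≤ N + 1) ∨ i ∈ S) := by
    intro i
    rw [mem_insert]
    constructor
    · rintro (h | h | h)
      · left; omega
      · left; omega
      · exact Or.inr h
    · rintro (h | h)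
      · by_cases hi : i = N + 1
        · exact Or.inr (Or.inl hi)
        · left; omega
      · exact Or.inr (Or.inr h)
  constructor
  · rintro ⟨h1, h2, h3⟩
    refine ⟨⟨fun p hp => ?_, fun i => (key i).symm.trans (h2 i), h3⟩, fun p hp => ?_⟩
    · have := h1 p hp; exact ⟨this.1, by omega⟩
    · have := h1 p hp; omega
  · rintro ⟨⟨h1, h2, h3⟩, h4⟩
    refine ⟨fun p hp => ?_, fun i => (key i).trans (h2 i), h3⟩
    have := h1 p hp; have := h4 p hp; exact ⟨by omega, by omega⟩

open Classical in
lemma completions_succ {N l d : ℕ} {S : Finset ℕ} (hS : ∀ x ∈ S, N + 1 < x)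
    (hl : N + 2 ≤ l) (hl' : l ≤ N + 3) :
    completions (N + 1) S l d = completions N (insert (N + 1) S) l d ∪
      {s ∈ S | s < d}.biUnion fun s =>
        (completions N (S.erase s) (N + 1) s).image (insert (N + 1, s)) := by
  ext X
  simp only [mem_union, mem_biUnion, mem_filter, mem_image, mem_completions,
    isPartialMatching_insert_iff]
  constructor
  · rintro ⟨hX, hnest, hd⟩
    by_cases hop : ∀ p ∈ X, p.1 ≠ N + 1
    · exact Or.inl ⟨⟨hX, hop⟩, hnest, hd⟩
    · push Not at hop
      obtain ⟨⟨a, s⟩, hs, rfl : a = N + 1⟩ := hop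
      obtain ⟨hsS, hX'⟩ := hX.erase_opener hS hs
      refine Or.inr ⟨s, ⟨hsS, hd _ hs hl'⟩, X.erase (N + 1, s), ⟨hX', ?_, ?_⟩, insert_erase hs⟩
      · exact fun h => hnest (has2Nesting_mono (erase_subset _ _) h)
      · intro p hp hpN
        have hpX := mem_of_mem_erase hp
        have hne := (hX.2.2 p hpX _ hs (ne_of_mem_erase hp)).2.2.2
        have hle := (hX'.1 p hp).2
        by_contra hlt
        refine hnest ⟨p, hpX, _, hs, ?_, hpN, (hX.1 _ hs).1, ?_⟩
        · simp only; omega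
        · simp only at hne ⊢; omega
  · rintro (⟨⟨hX, -⟩, hnest, hd⟩ | ⟨s, ⟨hsS, hsd⟩, X, ⟨hX, hnest, hd⟩, rfl⟩)
    · exact ⟨hX, hnest, hd⟩
    · refine ⟨hX.insert_opener hS hsS, ?_, ?_⟩
      · rintro ⟨p, hp, q, hq, h1, h2, h3, h4⟩
        rcases mem_insert.1 hp with rfl | hp <;> rcases mem_insert.1 hq with rfl | hq
        · exact lt_irrefl _ h1
        · have := (hX.1 q hq).2
          simp only at h1; omega
        · exact absurd (hd p hp h2) h4.not_gt
        · exact hnest ⟨p, hp, q, hq, h1, h2, h3, h4⟩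
      · intro p hp hlp
        rcases mem_insert.1 hp with rfl | hp
        · exact hsd
        · exact (hd p hp (by omega)).trans hsd

lemma card_completions_succ {N l d : ℕ} {S : Finset ℕ} (hS : ∀ x ∈ S, N + 1 < x)
    (hl : N + 2 ≤ l) (hl' : l ≤ N + 3) :
    (completions (N + 1) S l d).card = (completions N (insert (N + 1) S) l d).card +
      ∑ s ∈ S with s < d, (completions N (S.erase s) (N + 1) s).card := by
  classical
  rw [completions_succ hS hl hl', card_union_of_disjoint, card_biUnion]
  · congr 1
    refine sum_congr rfl fun s _ => card_image_of_injOn fun X hX Y hY hXY => ?_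
    have fresh : ∀ Z ∈ completions N (S.erase s) (N + 1) s, (N + 1, s) ∉ Z := fun Z hZ hs => by
      have := ((mem_completions.1 hZ).1.1 _ hs).2
      simp at this
    rw [← erase_insert (fresh X hX), ← erase_insert (fresh Y hY)]
    exact congrArg (fun Z => Z.erase (N + 1, s)) hXY
  · intro s hs s' hs' hne
    refine disjoint_left.2 fun X hX hX' => ?_
    obtain ⟨Y, hY, rfl⟩ := mem_image.1 hX
    obtain ⟨Z, -, hZ⟩ := mem_image.1 hX'
    have hmem : (N + 1, s') ∈ insert (N + 1, s) Y := hZ ▸ mem_insert_self _ _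
    rcases mem_insert.1 hmem with h | h
    · exact hne (Prod.ext_iff.1 h).2.symm
    · have := ((mem_completions.1 hY).1.1 _ h).2
      simp at this
  · rw [disjoint_left]
    intro X hX hX'
    obtain ⟨s, -, hs⟩ := mem_biUnion.1 hX'
    obtain ⟨Y, -, rfl⟩ := mem_image.1 hs
    exact (isPartialMatching_insert_iff.1 (mem_completions.1 hX).1).2 _ (mem_insert_self _ _) rfl

lemma completions_of_bound_vacuous {N l d : ℕ} {S : Finset ℕ} (hl : N + 3 ≤ l) :
    completions N S l d = completions N S (N + 1) (max N (S.sup id) + 1) := by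
  ext X
  simp only [mem_completions]
  refine and_congr_right fun hX => and_congr_right fun _ => ⟨fun _ p hp _ => ?_, fun _ p hp h => ?_⟩
  · rw [Nat.lt_succ_iff, le_max_iff]
    rcases (hX.2.1 p.2).2 ⟨p, hp, Or.inr rfl⟩ with h | h
    · exact Or.inl h.2
    · exact Or.inr (le_sup (f := id) h)
  · have := (hX.1 p hp).2
    omega

lemma sum_card_filter_lt {M : Type*} [AddCommMonoid M] (U : Finset ℕ) (f : ℕ → M) :
    ∑ s ∈ U, f (#{x ∈ U | x < s}) = ∑ i ∈ range #U, f i := by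
  induction U using Finset.induction_on_max with
  | empty => simp
  | insert a U ha ih =>
    have haU : a ∉ U := fun h => lt_irrefl _ (ha a h)
    rw [sum_insert haU, card_insert_of_notMem haU, sum_range_succ, ← ih, add_comm]
    congr 1
    · refine sum_congr rfl fun s hs => ?_
      rw [filter_insert, if_neg (ha s hs).not_gt]
    · rw [filter_insert, if_neg (lt_irrefl a), filter_true_of_mem ha]

lemma card_completions (b : Bool) (N d : ℕ) (S : Finset ℕ) (hS : ∀ x ∈ S, N < x) (hd : N < d) :
    (completions N S (N + 1 + b.toNat) d).card = countCompletions b N #S #{s ∈ S | s < d} := by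
  induction N generalizing b d S with
  | zero =>
    have hX : ∀ X ∈ completions 0 S (0 + 1 + b.toNat) d, X = ∅ := fun X hX => by
      obtain ⟨h1, h2, -⟩ := (mem_completions.1 hX).1
      refine eq_empty_of_forall_notMem fun p hp => ?_
      have h0 := (h1 p hp).2
      rcases (h2 p.1).2 ⟨p, hp, Or.inl rfl⟩ with h | h
      · omega
      · have := hS _ h; omega
    rcases S.eq_empty_or_nonempty with rfl | ⟨s, hs⟩
    · have : completions 0 ∅ (0 + 1 + b.toNat) d = {∅} := by
        refine eq_singleton_iff_unique_mem.2 ⟨?_, hX⟩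
        simp [mem_completions, IsPartialMatching, Has2Nesting]
        omega
      rw [this]
      simp [countCompletions]
    · have : completions 0 S (0 + 1 + b.toNat) d = ∅ := by
        refine eq_empty_of_forall_notMem fun X h => ?_
        obtain ⟨p, hp, -⟩ := ((mem_completions.1 h).1.2.1 s).1 (Or.inr hs)
        rw [hX X h] at hp
        simp at hp
      rw [this]
      simp [countCompletions, ne_empty_of_mem hs]
  | succ N ih =>
    have hmem : N + 1 ∉ S := fun h => lt_irrefl _ (hS _ h)
    have hS' : ∀ x ∈ insert (N + 1) S, N < x := by
      intro x hx
      rcases mem_insert.1 hx with rfl | hx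
      · omega
      · have := hS x hx; omega
    have hsum : ∑ s ∈ S with s < d, (completions N (S.erase s) (N + 1) s).card =
        ∑ i ∈ range #{s ∈ S | s < d}, countCompletions false N (#S - 1) i := by
      rw [← sum_card_filter_lt]
      refine sum_congr rfl fun s hs => ?_
      rw [mem_filter] at hs
      have := hS s hs.1
      have h := ih false s (S.erase s)
        (fun x hx => by have := hS x (mem_of_mem_erase hx); omega) (by omega)
      rw [Bool.toNat_false, add_zero, card_erase_of_mem hs.1] at h
      rw [h]
      congr 2
      ext x
      simp only [mem_filter, mem_erase]
      constructor
      · rintro ⟨⟨_, h⟩, h'⟩; exact ⟨⟨h, h'.trans hs.2⟩, h'⟩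
      · rintro ⟨⟨h, _⟩, h'⟩; exact ⟨⟨h'.ne, h⟩, h'⟩
    rw [card_completions_succ hS (by omega) (by cases b <;> simp), hsum]
    cases b with
    | false =>
      have h := ih true d (insert (N + 1) S) hS' (by omega)
      rw [filter_insert, if_pos hd, card_insert_of_notMem hmem,
        card_insert_of_notMem (by simp [hmem])] at h
      rw [countCompletions, ← h]
      simp
    | true =>
      have h := ih false (max N ((insert (N + 1) S).sup id) + 1) (insert (N + 1) S) hS' (by omega)
      have hall : ∀ x ∈ insert (N + 1) S, x < max N ((insert (N + 1) S).sup id) + 1 := fun x hx =>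
        Nat.lt_succ_iff.2 (le_max_of_le_right (le_sup (f := id) hx))
      rw [filter_true_of_mem hall, card_insert_of_notMem hmem, Bool.toNat_false, add_zero] at h
      rw [countCompletions, ← h, completions_of_bound_vacuous (by simp)]

lemma ncard_matchings_eq_countCompletions (n : ℕ) :
    {X : Finset (ℕ × ℕ) | IsMatching n X ∧ ¬ Has2Nesting X}.ncard =
      countCompletions false (2 * n) 0 0 := by
  have h := card_completions false (2 * n) (2 * n + 1) ∅ (by simp) (by omega)
  rw [filter_empty, card_empty] at h
  rw [← h, ← Set.ncard_coe_finset]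
  congr 1
  ext X
  simp only [Set.mem_ofPred_eq, mem_coe, mem_completions, IsMatching, IsPartialMatching,
    notMem_empty, or_false]
  constructor
  · rintro ⟨⟨h1, h2, h3⟩, h4⟩
    refine ⟨⟨fun p hp => ⟨h1 p hp, ((h2 p.1).2 ⟨p, hp, Or.inl rfl⟩).2⟩, h2, h3⟩, h4, ?_⟩
    exact fun p hp _ => Nat.lt_succ_iff.2 ((h2 p.2).2 ⟨p, hp, Or.inr rfl⟩).2
  · rintro ⟨⟨h1, h2, h3⟩, h4, -⟩
    exact ⟨⟨fun p hp => (h1 p hp).1, h2, h3⟩, h4⟩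

/-! ### Generating functions -/

section Identities

variable {R : Type*} [CommRing R]

/-- The square of the `q`-Pochhammer product `(1 - q) ⋯ (1 - q ^ n)`. -/
def qPochSq (q : R) (n : ℕ) : R := (∏ i ∈ range n, (1 - q ^ (i + 1))) ^ 2

/-- Truncated generating function of `countCompletions false · k j`. -/
def completionSum (q : R) (M k j : ℕ) : R :=
  ∑ n ∈ range M, q ^ (n + 1) * qPochSq q n * ((q ^ n - 1) ^ (k - j) * (q ^ (n + 1) - 1) ^ j)

lemma qPochSq_succ (q : R) (n : ℕ) : qPochSq q (n + 1) = qPochSq q n * (q ^ (n + 1) - 1) ^ 2 := by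
  rw [qPochSq, prod_range_succ, qPochSq]
  ring

lemma mul_sum_completionSum {q t : R} (hq : q * (1 - t) = 1) {M k j : ℕ} (hj : j ≤ k + 1) :
    t * ∑ i ∈ range j, completionSum q M k i =
      ∑ n ∈ range M, qPochSq q n *
        ((q ^ n - 1) ^ (k + 1 - j) * ((q ^ (n + 1) - 1) ^ j - (q ^ n - 1) ^ j)) := by
  induction j with
  | zero => simp
  | succ j ih =>
    rw [sum_range_succ, mul_add, ih (by omega), completionSum, mul_sum, ← sum_add_distrib]
    refine sum_congr rfl fun n _ => ?_
    obtain ⟨e, rfl⟩ : ∃ e, k = j + e := ⟨k - j, by omega⟩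
    rw [show j + e + 1 - j = e + 1 by omega, show j + e - j = e by omega,
      show j + e + 1 - (j + 1) = e by omega]
    linear_combination (-(q ^ n * qPochSq q n * ((q ^ n - 1) ^ e * (q ^ (n + 1) - 1) ^ j))) * hq

lemma completionSum_recurrence {q t : R} (hq : q * (1 - t) = 1) {M k j : ℕ} (hj : j ≤ k) :
    completionSum q M k j + qPochSq q M * q ^ M * (q ^ M - 1) ^ k =
      0 ^ k + (completionSum q M (k + 2) (k + 2) +
        t * ∑ i ∈ range (j + 1), completionSum q M k i) +
        t * ∑ i ∈ range j, completionSum q M (k - 1) i := by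
  have hprev : t * ∑ i ∈ range j, completionSum q M (k - 1) i =
      ∑ n ∈ range M, qPochSq q n *
        ((q ^ n - 1) ^ (k - j) * ((q ^ (n + 1) - 1) ^ j - (q ^ n - 1) ^ j)) := by
    rcases Nat.eq_zero_or_pos k with rfl | hk
    · obtain rfl : j = 0 := by omega
      simp
    · rw [mul_sum_completionSum hq (by omega)]
      simp only [Nat.sub_add_cancel hk]
  have htel := sum_range_sub (fun n => qPochSq q n * q ^ n * (q ^ n - 1) ^ k) M
  have h0 : qPochSq q 0 * q ^ 0 * (q ^ 0 - 1) ^ k = 0 ^ k := by simp [qPochSq]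
  rw [h0] at htel
  rw [hprev, mul_sum_completionSum hq (by omega), sub_eq_iff_eq_add'.1 htel.symm, completionSum,
    completionSum, Nat.add_sub_add_right, add_left_comm, add_assoc (0 ^ k)]
  congr 1
  simp only [← sum_add_distrib]
  refine sum_congr rfl fun n _ => ?_
  obtain ⟨e, rfl⟩ : ∃ e, k = j + e := ⟨k - j, by omega⟩
  rw [qPochSq_succ, Nat.sub_self, Nat.add_sub_add_right, Nat.add_sub_cancel_left]
  ring

/-- Truncated form of the function interpolating between the two series for the Fishburn
numbers. -/
def interpolant (q : R) (M N : ℕ) : R :=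
  ∑ n ∈ range M, q ^ (n + 1 + N) *
    ((∏ i ∈ range n, (1 - q ^ (i + 1))) * ∏ i ∈ range n, (1 - q ^ (N + i + 1)))

lemma interpolant_eq {q p : R} (hq : q * p = 1) (M N : ℕ) :
    interpolant q M N = 1 -
      (∏ i ∈ range M, (1 - q ^ (i + 1))) * ∏ i ∈ range M, (1 - q ^ (N + i + 1)) +
      (1 - p ^ (N + 1)) * interpolant q M (N + 1) := by
  have htel := sum_range_sub' (fun n =>
    (∏ i ∈ range n, (1 - q ^ (i + 1))) * ∏ i ∈ range n, (1 - q ^ (N + i + 1))) M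
  rw [range_zero, prod_empty, prod_empty, one_mul] at htel
  rw [← htel, interpolant, interpolant, mul_sum, ← sum_add_distrib]
  refine sum_congr rfl fun n _ => ?_
  have hpq : q ^ (N + 1) * p ^ (N + 1) = 1 := by rw [← mul_pow, hq, one_pow]
  have hshift : (1 - q ^ (N + 1)) * ∏ i ∈ range n, (1 - q ^ (N + 1 + i + 1)) =
      (∏ i ∈ range n, (1 - q ^ (N + i + 1))) * (1 - q ^ (N + n + 1)) := by
    rw [← prod_range_succ, prod_range_succ', mul_comm, add_zero]
    congr 1
    exact prod_congr rfl fun i _ => by congr 2; ring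
  rw [prod_range_succ, prod_range_succ]
  linear_combination (q ^ (n + 1) * ∏ i ∈ range n, (1 - q ^ (i + 1))) * hshift +
    (q ^ (n + 1) * (∏ i ∈ range n, (1 - q ^ (i + 1))) *
      ∏ i ∈ range n, (1 - q ^ (N + 1 + i + 1))) * hpq

lemma interpolant_zero {q p : R} (hq : q * p = 1) (M K : ℕ) :
    interpolant q M 0 = ∑ m ∈ range K, (∏ i ∈ range m, (1 - p ^ (i + 1))) * (1 -
      (∏ i ∈ range M, (1 - q ^ (i + 1))) * ∏ i ∈ range M, (1 - q ^ (m + i + 1))) +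
      (∏ i ∈ range K, (1 - p ^ (i + 1))) * interpolant q M K := by
  induction K with
  | zero => simp
  | succ K ih =>
    rw [ih, sum_range_succ, prod_range_succ, interpolant_eq hq M K]
    ring

end Identities

lemma X_dvd_one_sub_pow {f : PowerSeries ℤ} (hf : constantCoeff f = 1) (m : ℕ) :
    X ∣ 1 - f ^ m := by
  rw [X_dvd_iff]
  simp [hf]

lemma X_pow_dvd_prod_one_sub_pow {f : PowerSeries ℤ} (hf : constantCoeff f = 1) (n : ℕ)
    (e : ℕ → ℕ) : X ^ n ∣ ∏ i ∈ range n, (1 - f ^ e i) := by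
  simpa using prod_dvd_prod_of_dvd (s := range n) (fun _ => (X : PowerSeries ℤ)) _
    fun i _ => X_dvd_one_sub_pow hf (e i)

lemma X_pow_dvd_completionSum {q : PowerSeries ℤ} (hq : constantCoeff q = 1) (M : ℕ) {k j : ℕ}
    (hj : j ≤ k) : X ^ k ∣ completionSum q M k j := by
  refine dvd_sum fun n _ => Dvd.dvd.mul_left ?_ _
  rw [← Nat.sub_add_cancel hj, pow_add, Nat.add_sub_cancel]
  refine mul_dvd_mul (pow_dvd_pow_of_dvd ?_ _) (pow_dvd_pow_of_dvd ?_ _)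
  all_goals rw [← neg_sub, dvd_neg]; exact X_dvd_one_sub_pow hq _

lemma coeff_eq_zero_of_X_pow_dvd {f : PowerSeries ℤ} {m k : ℕ} (h : X ^ k ∣ f) (hm : m < k) :
    coeff m f = 0 :=
  X_pow_dvd_iff.1 h m hm

lemma X_pow_dvd_qPochSq {q : PowerSeries ℤ} (hq : constantCoeff q = 1) (M : ℕ) :
    X ^ (2 * M) ∣ qPochSq q M := by
  rw [mul_comm, pow_mul]
  exact pow_dvd_pow_of_dvd (X_pow_dvd_prod_one_sub_pow hq M _) 2

lemma countCompletions_eq_coeff {q : PowerSeries ℤ} (hq : q * (1 - X) = 1) (M N : ℕ) :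
    (∀ k j m, j ≤ k → 2 * m = N + k → m < 2 * M →
      (countCompletions false N k j : ℤ) = coeff m (completionSum q M k j)) ∧
    (∀ k j m, j ≤ k + 1 → 2 * m = N + (k + 1) → m < 2 * M →
      (countCompletions true N (k + 1) j : ℤ) =
        coeff m (completionSum q M (k + 2) (k + 2) +
          X * ∑ i ∈ range j, completionSum q M k i)) := by
  have hq1 : constantCoeff q = 1 := by simpa using congrArg (constantCoeff (R := ℤ)) hq
  have hrec : ∀ k j m, j ≤ k → m < 2 * M → coeff m (completionSum q M k j) =
      coeff m (0 ^ k : PowerSeries ℤ) + coeff m (completionSum q M (k + 2) (k + 2) +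
        X * ∑ i ∈ range (j + 1), completionSum q M k i) +
        coeff m (X * ∑ i ∈ range j, completionSum q M (k - 1) i) := by
    intro k j m hj hm
    have h := congrArg (coeff m) (completionSum_recurrence hq (M := M) hj)
    rw [map_add, map_add, map_add,
      coeff_eq_zero_of_X_pow_dvd (((X_pow_dvd_qPochSq hq1 M).mul_right _).mul_right _) hm,
      add_zero] at h
    exact h
  have hdvd : ∀ k j, j ≤ k + 1 → X ^ (k + 1) ∣ completionSum q M (k + 2) (k + 2) +
      X * ∑ i ∈ range j, completionSum q M k i := by
    intro k j hj
    refine dvd_add ((pow_dvd_pow X (by omega)).trans (X_pow_dvd_completionSum hq1 M le_rfl)) ?_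
    rw [pow_succ']
    refine mul_dvd_mul_left _ (dvd_sum fun i hi => X_pow_dvd_completionSum hq1 M ?_)
    have := mem_range.1 hi
    omega
  induction N with
  | zero =>
    refine ⟨fun k j m hj hm hM => ?_, fun k j m hj hm hM => ?_⟩
    · rcases Nat.eq_zero_or_pos k with rfl | hk
      · obtain rfl : m = 0 := by omega
        obtain rfl : j = 0 := by omega
        rw [hrec 0 0 0 le_rfl hM, coeff_eq_zero_of_X_pow_dvd (hdvd 0 1 le_rfl) (by omega)]
        simp [countCompletions]
      · rw [coeff_eq_zero_of_X_pow_dvd (X_pow_dvd_completionSum hq1 M hj) (by omega)]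
        simp [countCompletions, hk.ne']
    · rw [coeff_eq_zero_of_X_pow_dvd (hdvd k j hj) (by omega)]
      simp [countCompletions]
  | succ N ih =>
    obtain ⟨ihf, iht⟩ := ih
    refine ⟨fun k j m hj hm hM => ?_, fun k j m hj hm hM => ?_⟩
    · obtain ⟨m, rfl⟩ : ∃ m', m = m' + 1 := ⟨m - 1, by omega⟩
      have hzero : coeff (m + 1) (0 ^ k : PowerSeries ℤ) = 0 := by
        rcases Nat.eq_zero_or_pos k with rfl | hk
        · simp [coeff_one]
        · simp [zero_pow hk.ne']
      rw [hrec k j _ hj hM, hzero, zero_add, ← iht k (j + 1) (m + 1) (by omega) (by omega) hM,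
        coeff_succ_X_mul, map_sum, countCompletions, Nat.cast_add, Nat.cast_sum]
      congr 1
      refine sum_congr rfl fun i hi => ?_
      have := mem_range.1 hi
      exact ihf _ _ _ (by omega) (by omega) (by omega)
    · obtain ⟨m, rfl⟩ : ∃ m', m = m' + 1 := ⟨m - 1, by omega⟩
      rw [map_add, coeff_succ_X_mul, map_sum, countCompletions, Nat.cast_add, Nat.cast_sum,
        ihf _ _ (m + 1) le_rfl (by omega) hM]
      congr 1
      refine sum_congr rfl fun i hi => ?_
      have := mem_range.1 hi
      exact ihf _ _ _ (by omega) (by omega) (by omega)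

lemma coe_fishburnPoly (n : ℕ) : (fishburnPoly n : PowerSeries ℤ) =
    ∑ m ∈ range (n + 1), ∏ i ∈ range m, (1 - (1 - X) ^ (i + 1)) := by
  have h : fishburnPoly n =
      ∑ m ∈ range (n + 1), ∏ i ∈ range m, (1 - (1 - Polynomial.X) ^ (i + 1)) := by
    rw [fishburnPoly, sum_range_succ', prod_range_zero, add_comm, range_eq_Ico,
      sum_Ico_add' (fun m => ∏ i ∈ range m, (1 - (1 - (Polynomial.X : Polynomial ℤ)) ^ (i + 1)))]
    congr 1
    refine sum_congr (by ext; simp) fun m _ => ?_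
    rw [range_eq_Ico, prod_Ico_add' (fun i => 1 - (1 - (Polynomial.X : Polynomial ℤ)) ^ i)]
    exact prod_congr (by ext; simp) fun _ _ => rfl
  rw [h, ← Polynomial.coeToPowerSeries.ringHom_apply]
  simp [map_sum, map_prod]

lemma coeff_completionSum_zero {q : PowerSeries ℤ} (hq : q * (1 - X) = 1) {M n : ℕ}
    (hn : n < 2 * M) : coeff n (completionSum q M 0 0) = (fishburnPoly n).coeff n := by
  have hq1 : constantCoeff q = 1 := by simpa using congrArg (constantCoeff (R := ℤ)) hq
  have h : completionSum q M 0 0 = interpolant q M 0 := by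
    refine sum_congr rfl fun n _ => ?_
    simp only [qPochSq, zero_add, add_zero]
    ring
  rw [h, interpolant_zero hq M (n + 1), ← Polynomial.coeff_coe, coe_fishburnPoly, map_add,
    coeff_eq_zero_of_X_pow_dvd ((X_pow_dvd_prod_one_sub_pow (by simp) (n + 1) _).mul_right _)
      n.lt_succ_self, add_zero, map_sum, map_sum]
  refine sum_congr rfl fun m _ => ?_
  rw [mul_sub, mul_one, map_sub, sub_eq_self]
  refine coeff_eq_zero_of_X_pow_dvd (Dvd.dvd.mul_left ?_ _) hn
  rw [two_mul, pow_add]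
  exact mul_dvd_mul (X_pow_dvd_prod_one_sub_pow hq1 M _) (X_pow_dvd_prod_one_sub_pow hq1 M _)

/-- For `n ≥ 1`, the number of matchings on `[2n]` with no 2-nestings is the `n`-th
Fishburn number, i.e. the coefficient of `t^n` in
`1 + Σ_{m=1}^{n} ∏_{i=1}^{m} (1 - (1-t)^i)`.  (Conjecture of Claesson and Linusson.) -/
theorem matchings_no_two_nesting_card_eq_fishburn (n : ℕ) (hn : 1 ≤ n) :
    ({X : Finset (ℕ × ℕ) | IsMatching n X ∧ ¬ Has2Nesting X}.ncard : ℤ) =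
      (fishburnPoly n).coeff n := by
  have hq : (PowerSeries.mk 1 : PowerSeries ℤ) * (1 - X) = 1 :=
    PowerSeries.mk_one_mul_one_sub_eq_one ℤ
  rw [ncard_matchings_eq_countCompletions,
    (countCompletions_eq_coeff hq n (2 * n)).1 0 0 n le_rfl rfl (by omega)]
  exact coeff_completionSum_zero hq (by omega)
end

section
/- For every n ≥ 1, Σ_{A_1 A_2 ... A_k ∈ Y_n} (-1)^{n-k} = |T_n|, where the sum ranges over all Fishburn diagrams with n dots (k being the number of columns of the diagram). -/
/-- The Fishburn diagrams with `k` columns: sequences of sets `A_1 … A_k` (indexed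
0-based by `Fin k`) with each `A_i` a nonempty subset of `{0, 1, …, i-1}`
(0-based: `A i ⊆ {0, …, i}`). -/
def fishburnDiagrams (k : ℕ) : Finset (Fin k → Finset ℕ) :=
  Fintype.piFinset fun i => ((Finset.range (i.1 + 1)).powerset.erase ∅)

/-- The number of dots of a Fishburn diagram. -/
def dots {k : ℕ} (A : Fin k → Finset ℕ) : ℕ := ∑ i, (A i).card

open Finset PowerSeries

/-- The power series `∑ₙ Xⁿ vₙ`. -/
noncomputable def xsum (v : ℕ → ℤ⟦X⟧) : ℤ⟦X⟧ :=
  PowerSeries.mk fun N => ∑ n ∈ range (N + 1), coeff (N - n) (v n)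

lemma xsum_eq_add (v : ℕ → ℤ⟦X⟧) : xsum v = v 0 + X * xsum fun n => v (n + 1) := by
  ext N
  cases N with
  | zero => simp [xsum]
  | succ N =>
    rw [map_add, coeff_succ_X_mul, xsum, xsum, coeff_mk, coeff_mk, sum_range_succ', add_comm]
    simp

lemma xsum_add (v w : ℕ → ℤ⟦X⟧) : (xsum fun n => v n + w n) = xsum v + xsum w := by
  ext N
  simp [xsum, sum_add_distrib]

lemma eq_of_forall_X_pow_dvd {f g : ℤ⟦X⟧} (h : ∀ N, X ^ N ∣ f - g) : f = g := by
  ext N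
  have := X_pow_dvd_iff.1 (h (N + 1)) N (Nat.lt_succ_self N)
  rwa [map_sub, sub_eq_zero] at this

lemma xsum_mul (c : ℤ⟦X⟧) (v : ℕ → ℤ⟦X⟧) : (xsum fun n => c * v n) = c * xsum v := by
  refine eq_of_forall_X_pow_dvd fun N => ?_
  induction N generalizing v with
  | zero => simp
  | succ N ih =>
    obtain ⟨r, hr⟩ := ih fun n => v (n + 1)
    rw [xsum_eq_add, xsum_eq_add v]
    exact ⟨r, by linear_combination X * hr⟩

/-- A recursion `A k = c k + X * h k * A (k + 1)` has at most one solution. -/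
lemma eq_of_recursion {A B c h : ℕ → ℤ⟦X⟧} (hA : ∀ k, A k = c k + X * h k * A (k + 1))
    (hB : ∀ k, B k = c k + X * h k * B (k + 1)) (k : ℕ) : A k = B k := by
  refine eq_of_forall_X_pow_dvd fun N => ?_
  induction N generalizing k with
  | zero => simp
  | succ N ih =>
    obtain ⟨r, hr⟩ := ih (k + 1)
    exact ⟨h k * r, by rw [hA, hB]; linear_combination X * h k * hr⟩

/-- The transfer operator of the slot-by-slot construction of the inversion tables
avoiding `j + 1` before `j`. -/
noncomputable def transfer : (ℕ → ℕ → ℤ⟦X⟧) →ₗ[ℤ⟦X⟧] (ℕ → ℕ → ℤ⟦X⟧) where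
  toFun f d x := f 0 (d + x + 1) +
    ∑ t ∈ range x, ∑ r ∈ range (x - 1 - t + 1), ((x - 1 - t).choose r : ℤ⟦X⟧) * f (d + r) (t + 1)
  map_add' f g := by
    funext d x
    simp only [Pi.add_apply, mul_add, sum_add_distrib]
    ring
  map_smul' c f := by
    funext d x
    simp only [Pi.smul_apply, smul_eq_mul, RingHom.id_apply, mul_add, mul_sum, mul_left_comm]

lemma transfer_apply (f : ℕ → ℕ → ℤ⟦X⟧) (d x : ℕ) :
    transfer f d x = f 0 (d + x + 1) + ∑ t ∈ range x, ∑ r ∈ range (x - 1 - t + 1),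
      ((x - 1 - t).choose r : ℤ⟦X⟧) * f (d + r) (t + 1) := rfl

/-- The function `(d, x) ↦ z ^ d * u ^ x`. -/
noncomputable def expFun (z u : ℤ⟦X⟧) : ℕ → ℕ → ℤ⟦X⟧ := fun d x => z ^ d * u ^ x

lemma transfer_expFun (z u : ℤ⟦X⟧) :
    (u - z - 1) • transfer (expFun z u) =
      ((u - z - 1) * u) • expFun u u + u • (expFun z u - expFun z (z + 1)) := by
  funext d x
  have h (t : ℕ) : ∑ r ∈ range (x - 1 - t + 1),
      ((x - 1 - t).choose r : ℤ⟦X⟧) * (z ^ (d + r) * u ^ (t + 1)) =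
      z ^ d * u * (u ^ t * (z + 1) ^ (x - 1 - t)) := by
    rw [add_pow, mul_sum, mul_sum]
    exact sum_congr rfl fun r _ => by ring
  have hg := (Commute.all u (z + 1)).geom_sum₂_mul x
  simp only [Pi.smul_apply, Pi.add_apply, Pi.sub_apply, smul_eq_mul, transfer_apply, expFun, h,
    ← mul_sum]
  linear_combination z ^ d * u * hg

/-- The generating function `∑ₙ Xⁿ (transferⁿ f) (0, 0)`. -/
noncomputable def pathSum (f : ℕ → ℕ → ℤ⟦X⟧) : ℤ⟦X⟧ := xsum fun n => (transfer ^ n) f 0 0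

lemma pathSum_add (f g : ℕ → ℕ → ℤ⟦X⟧) : pathSum (f + g) = pathSum f + pathSum g := by
  simp [pathSum, xsum_add]

lemma pathSum_smul (c : ℤ⟦X⟧) (f : ℕ → ℕ → ℤ⟦X⟧) : pathSum (c • f) = c * pathSum f := by
  simp [pathSum, xsum_mul]

lemma pathSum_eq_add (f : ℕ → ℕ → ℤ⟦X⟧) : pathSum f = f 0 0 + X * pathSum (transfer f) := by
  rw [pathSum, xsum_eq_add]
  simp [pathSum, pow_succ]

lemma pathSum_expFun (z u : ℤ⟦X⟧) :
    (u - z - 1) * (pathSum (expFun z u) - 1) =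
      X * ((u - z - 1) * u * pathSum (expFun u u) +
        u * (pathSum (expFun z u) - pathSum (expFun z (z + 1)))) := by
  have h := congrArg pathSum (transfer_expFun z u)
  rw [sub_eq_add_neg (expFun z u), ← neg_one_smul ℤ⟦X⟧ (expFun z (z + 1))] at h
  simp only [pathSum_add, pathSum_smul] at h
  have h1 := pathSum_eq_add (expFun z u)
  have h0 : expFun z u 0 0 = 1 := by simp [expFun]
  rw [h0] at h1
  linear_combination (u - z - 1) * h1 + X * h

lemma pathSum_expFun_self (z : ℤ⟦X⟧) :
    pathSum (expFun z z) = 1 + X * z * pathSum (expFun z (z + 1)) := by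
  linear_combination -pathSum_expFun z z

lemma pathSum_expFun_succ {z w : ℤ⟦X⟧} (h : (1 - X) * w = z + 1) (hw : w ≠ 0) :
    pathSum (expFun z (z + 1)) = 1 + X * w * pathSum (expFun w w) := by
  refine mul_left_cancel₀ (mul_ne_zero (X_ne_zero (R := ℤ)) hw) ?_
  linear_combination pathSum_expFun z w -
    (pathSum (expFun z w) - 1 - X * w * pathSum (expFun w w)) * h

/-- The series `∑ⱼ qˡʲ ∏_{i < j} (1 - (1 - X)ᵏ⁺ⁱ)`. -/
noncomputable def fishburnSeries (q : ℤ⟦X⟧) (k l : ℕ) : ℤ⟦X⟧ :=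
  xsum fun j => q ^ (l * j) * ∏ i ∈ range j, ∑ s ∈ range (k + i), (1 - X) ^ s

lemma X_mul_geom_sum (k : ℕ) :
    (X : ℤ⟦X⟧) * ∑ s ∈ range k, (1 - X) ^ s = 1 - (1 - X) ^ k := by
  linear_combination mul_neg_geom_sum (1 - X : ℤ⟦X⟧) k

lemma fishburnSeries_eq_add (q : ℤ⟦X⟧) (k l : ℕ) :
    fishburnSeries q k l = 1 + q ^ l * (1 - (1 - X) ^ k) * fishburnSeries q (k + 1) l := by
  have h : (fun j => q ^ (l * (j + 1)) * ∏ i ∈ range (j + 1), ∑ s ∈ range (k + i), (1 - X) ^ s) =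
      fun j => (q ^ l * ∑ s ∈ range k, (1 - X) ^ s) *
        (q ^ (l * j) * ∏ i ∈ range j, ∑ s ∈ range (k + 1 + i), (1 - X : ℤ⟦X⟧) ^ s) := by
    funext j
    rw [prod_range_succ', mul_add, pow_add]
    simp only [add_right_comm k _ 1, ← add_assoc, add_zero, mul_one]
    ring
  rw [fishburnSeries, xsum_eq_add, h, xsum_mul, ← fishburnSeries, ← X_mul_geom_sum]
  simp
  ring

lemma fishburnSeries_succ {q : ℤ⟦X⟧} (hq : (1 - X) * q = 1) (k l : ℕ) :
    fishburnSeries q k (l + 1) = 1 + q ^ (l + 1) * fishburnSeries q k (l + 1) -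
      (1 - X) ^ k * q ^ (l + 1) * fishburnSeries q k l := by
  have h : (fun j => X * (q ^ ((l + 1) * (j + 1)) *
        ∏ i ∈ range (j + 1), ∑ s ∈ range (k + i), (1 - X : ℤ⟦X⟧) ^ s)) =
      fun j => q ^ (l + 1) *
          (q ^ ((l + 1) * j) * ∏ i ∈ range j, ∑ s ∈ range (k + i), (1 - X : ℤ⟦X⟧) ^ s) +
        -((1 - X) ^ k * q ^ (l + 1)) *
          (q ^ (l * j) * ∏ i ∈ range j, ∑ s ∈ range (k + i), (1 - X : ℤ⟦X⟧) ^ s) := by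
    funext j
    have h1 := X_mul_geom_sum (k + j)
    have h2 : (1 - X) ^ (k + j) * q ^ ((l + 1) * j) = (1 - X) ^ k * q ^ (l * j) := by
      rw [add_mul, one_mul, pow_add, pow_add]
      have : ((1 - X) * q) ^ j = 1 := by rw [hq, one_pow]
      rw [mul_pow] at this
      linear_combination (1 - X) ^ k * q ^ (l * j) * this
    rw [prod_range_succ, mul_add, pow_add, mul_one]
    generalize ∏ i ∈ range j, ∑ s ∈ range (k + i), (1 - X : ℤ⟦X⟧) ^ s = P
    linear_combination q ^ (l + 1) * q ^ ((l + 1) * j) * P * h1 - q ^ (l + 1) * P * h2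
  conv_lhs => rw [fishburnSeries, xsum_eq_add, ← xsum_mul, h, xsum_add, xsum_mul, xsum_mul]
  rw [fishburnSeries, fishburnSeries]
  simp
  ring

theorem pathSum_eq_fishburnSeries :
    pathSum (expFun 0 1) = fishburnSeries (PowerSeries.mk 1) 1 0 := by
  have hq : (1 - X : ℤ⟦X⟧) * PowerSeries.mk 1 = 1 := by
    rw [mul_comm]; exact PowerSeries.mk_one_mul_one_sub_eq_one ℤ
  generalize (PowerSeries.mk 1 : ℤ⟦X⟧) = q at *
  set z : ℕ → ℤ⟦X⟧ := fun k => ∑ j ∈ range k, q ^ (j + 1) with hz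
  have hXz (k : ℕ) : X * z k = q ^ k - 1 := by
    induction k with
    | zero => simp [hz]
    | succ k ih =>
      simp only [hz, sum_range_succ, mul_add] at ih ⊢
      linear_combination ih - q ^ k * hq
  have hyz (k : ℕ) : (1 - X) * z (k + 1) = z k + 1 := by
    simp only [hz, sum_range_succ, sub_mul, one_mul]
    have := hXz (k + 1)
    simp only [hz, sum_range_succ] at this
    linear_combination -this
  have hz0 (k : ℕ) : z (k + 1) ≠ 0 := by
    intro h
    have hc : constantCoeff q = 1 := by simpa using congrArg constantCoeff hq
    have h1 := congrArg constantCoeff h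
    simp only [hz, map_sum, map_pow, hc, one_pow, sum_const, card_range, map_zero, nsmul_one] at h1
    exact Nat.cast_ne_zero.2 k.succ_ne_zero h1
  have hyq (k : ℕ) : (1 - X) ^ k * q ^ k = 1 := by rw [← mul_pow, hq, one_pow]
  have := eq_of_recursion (A := fun k => pathSum (expFun (z k) (z k + 1)))
    (B := fun k => fishburnSeries q (k + 1) k) (c := fun k => 1 + X * z (k + 1))
    (h := fun k => z (k + 1) * (X * z (k + 1))) (fun k => ?_) (fun k => ?_) 0
  · simpa [hz] using this
  · linear_combination pathSum_expFun_succ (hyz k) (hz0 k) +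
      X * z (k + 1) * pathSum_expFun_self (z (k + 1))
  · have h1 := fishburnSeries_eq_add q (k + 1) (k + 1)
    have h2 := fishburnSeries_succ hq (k + 1) k
    have h3 := hyq (k + 1)
    have h4 := hXz (k + 1)
    have h5 : fishburnSeries q (k + 1) (k + 1) =
        1 + X * z (k + 1) * fishburnSeries q (k + 1 + 1) (k + 1) := by
      linear_combination h1 - fishburnSeries q (k + 1 + 1) (k + 1) * (h3 + h4)
    linear_combination h2 - fishburnSeries q (k + 1) k * h3 + X * z (k + 1) * h5 -
      fishburnSeries q (k + 1) (k + 1) * h4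

/-- Classification of the nonempty subsets of `s` by the number `t` of elements of `s` below the
subset, and the number `r` of the other elements of `s` outside it. -/
lemma sum_powerset_nonempty {α : Type*} [LinearOrder α] {R : Type*} [CommSemiring R]
    (s : Finset α) (g : ℕ → ℕ → R) :
    ∑ Y ∈ s.powerset, (if Y = ∅ then 0 else
      g (#{q ∈ s | q ∉ Y ∧ ¬ ∀ p ∈ Y, q < p}) (#{q ∈ s | ∀ p ∈ Y, q < p})) =
    ∑ t ∈ range #s, ∑ r ∈ range (#s - 1 - t + 1), ((#s - 1 - t).choose r : R) * g r t := by
  induction s using Finset.induction_on_min generalizing g with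
  | empty => simp
  | insert a s ha ih =>
    have has : a ∉ s := fun h => lt_irrefl _ (ha a h)
    rw [sum_powerset_insert has, card_insert_of_notMem has, sum_range_succ']
    congr 1
    · have h := ih fun r t => g r (t + 1)
      have h' : ∀ t, #s - 1 - t = #s + 1 - 1 - (t + 1) := by omega
      simp only [h'] at h
      rw [← h]
      refine sum_congr rfl fun Y hY => ?_
      have hY' := mem_powerset.1 hY
      split_ifs with h0
      · rfl
      · congr 1
        · rw [filter_insert, if_neg]
          rintro ⟨-, h2⟩
          exact h2 fun p hp => ha p (hY' hp)
        · rw [filter_insert, if_pos fun p hp => ha p (hY' hp), card_insert_of_notMem]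
          simp [has]
    · have h (Y) (hY : Y ∈ s.powerset) : (if insert a Y = ∅ then 0 else
          g (#{q ∈ insert a s | q ∉ insert a Y ∧ ¬ ∀ p ∈ insert a Y, q < p})
            (#{q ∈ insert a s | ∀ p ∈ insert a Y, q < p})) = g (#s - #Y) 0 := by
        have hY' := mem_powerset.1 hY
        rw [if_neg (insert_ne_empty a Y), ← card_sdiff_of_subset hY']
        congr 2
        · ext q
          simp only [mem_filter, mem_insert, mem_sdiff, not_or]
          constructor
          · rintro ⟨rfl | h1, h2, h3⟩
            · exact absurd rfl h2.1
            · exact ⟨h1, h2.2⟩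
          · rintro ⟨h1, h2⟩
            exact ⟨Or.inr h1, ⟨(ha q h1).ne', h2⟩, fun h => lt_asymm (ha q h1) (h a (Or.inl rfl))⟩
        · rw [card_eq_zero, filter_eq_empty_iff]
          intro q hq h
          have := h a (mem_insert_self a Y)
          rcases mem_insert.1 hq with rfl | hq
          · exact lt_irrefl _ this
          · exact lt_asymm this (ha q hq)
      rw [sum_congr rfl h, sum_powerset_apply_card fun m => g (#s - m) 0, ← sum_flip]
      simp only [Nat.add_sub_cancel, Nat.sub_zero, nsmul_eq_mul]
      refine sum_congr rfl fun r hr => ?_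
      have hr' : r ≤ #s := by simpa [Nat.lt_succ_iff] using hr
      rw [Nat.choose_symm hr', Nat.sub_sub_self hr']

/-- The inversion tables of length `n` in which no value `j + 1` precedes a value `j`. -/
def avoidingTables (n : ℕ) : Finset (Fin n → ℕ) :=
  {a ∈ Fintype.piFinset fun i : Fin n => range (i.1 + 1) | ¬ ∃ p q : Fin n, p < q ∧ a p = a q + 1}

lemma mem_avoidingTables {n : ℕ} {a : Fin n → ℕ} :
    a ∈ avoidingTables n ↔ (∀ i, a i ≤ i.1) ∧ ∀ p q : Fin n, p < q → a p ≠ a q + 1 := by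
  simp [avoidingTables]

/-- Extend the shape `d` of the slots above `i + 1` by the set `Y` of entries in slot `i + 1`. -/
def extendShape {n : ℕ} (d : Fin n → ℕ) (Y : Finset (Fin n)) (p : Fin n) : ℕ :=
  if p ∈ Y then 1 else if d p = 0 then 0 else d p + 1

/-- The entries which may lie in slot `i`. -/
def freeEntries {n : ℕ} (i : ℕ) (d : Fin n → ℕ) : Finset (Fin n) :=
  {p | i ≤ p.1 ∧ d p = 0 ∧ ∀ r, d r = 1 → p < r}

/-- The entries at position `i` or later which must lie in a slot below `i`. -/
def blockedEntries {n : ℕ} (i : ℕ) (d : Fin n → ℕ) : Finset (Fin n) :=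
  {p | i ≤ p.1 ∧ d p = 0 ∧ ¬ ∀ r, d r = 1 → p < r}

lemma extendShape_eq_zero {n : ℕ} {d : Fin n → ℕ} {Y : Finset (Fin n)} {p : Fin n} :
    extendShape d Y p = 0 ↔ p ∉ Y ∧ d p = 0 := by
  unfold extendShape; split_ifs <;> simp_all

lemma extendShape_eq_one {n : ℕ} {d : Fin n → ℕ} {Y : Finset (Fin n)} {p : Fin n} :
    extendShape d Y p = 1 ↔ p ∈ Y := by
  unfold extendShape; split_ifs <;> simp_all

lemma card_freeEntries_empty {n i : ℕ} (hi : i < n) {d : Fin n → ℕ} (hd : d ⟨i, hi⟩ = 0) :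
    #(freeEntries i (extendShape d ∅)) =
      #(blockedEntries (i + 1) d) + #(freeEntries (i + 1) d) + 1 := by
  rw [← card_union_of_disjoint, ← card_insert_of_notMem (a := ⟨i, hi⟩)]
  · congr 1
    ext p
    simp only [freeEntries, blockedEntries, mem_filter, mem_univ, mem_union, mem_insert, true_and,
      extendShape_eq_zero, extendShape_eq_one, Fin.ext_iff]
    rcases eq_or_ne p.1 i with h | h
    · obtain rfl : p = ⟨i, hi⟩ := Fin.ext h
      simp [hd]
    · have : i ≤ p.1 ↔ i + 1 ≤ p.1 := by omega
      simp only [h, this]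
      tauto
  · simp [freeEntries, blockedEntries]
  · rw [disjoint_left]
    simp +contextual [freeEntries, blockedEntries]

lemma card_blockedEntries_empty {n : ℕ} (i : ℕ) (d : Fin n → ℕ) :
    #(blockedEntries i (extendShape d ∅)) = 0 := by
  simp [blockedEntries, extendShape_eq_one]

lemma card_freeEntries {n i : ℕ} (hi : i < n) {d : Fin n → ℕ} (hd : d ⟨i, hi⟩ = 0)
    {Y : Finset (Fin n)} (hY : Y ⊆ freeEntries (i + 1) d) (hY0 : Y ≠ ∅) :
    #(freeEntries i (extendShape d Y)) = #{q ∈ freeEntries (i + 1) d | ∀ p ∈ Y, q < p} + 1 := by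
  rw [← card_insert_of_notMem (a := ⟨i, hi⟩)]
  · congr 1
    ext p
    simp only [freeEntries, mem_filter, mem_univ, mem_insert, true_and,
      extendShape_eq_zero, extendShape_eq_one]
    have hY1 : ∀ q ∈ Y, i + 1 ≤ q.1 ∧ d q = 0 ∧ ∀ r, d r = 1 → q < r := fun q hq => by
      simpa [freeEntries] using hY hq
    constructor
    · rintro ⟨h1, ⟨h2, h3⟩, h4⟩
      rcases eq_or_ne p.1 i with h | h
      · exact Or.inl (Fin.ext h)
      · obtain ⟨q, hq⟩ := nonempty_iff_ne_empty.2 hY0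
        exact Or.inr ⟨⟨by omega, h3, fun r hr => (h4 q hq).trans ((hY1 q hq).2.2 r hr)⟩, h4⟩
    · rintro (rfl | ⟨⟨h1, h2, h3⟩, h4⟩)
      · refine ⟨le_rfl, ⟨fun h => ?_, hd⟩, fun r hr => ?_⟩
        · have := (hY1 _ h).1
          simp at this
        · exact Fin.lt_def.2 (hY1 r hr).1
      · exact ⟨by omega, ⟨fun h => lt_irrefl _ (h4 p h), h2⟩, h4⟩
  · simp [freeEntries]

lemma card_blockedEntries {n i : ℕ} {d : Fin n → ℕ}
    {Y : Finset (Fin n)} (hY : Y ⊆ freeEntries (i + 1) d) (hY0 : Y ≠ ∅) :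
    #(blockedEntries i (extendShape d Y)) = #(blockedEntries (i + 1) d) +
      #{q ∈ freeEntries (i + 1) d | q ∉ Y ∧ ¬ ∀ p ∈ Y, q < p} := by
  have hY1 : ∀ q ∈ Y, i + 1 ≤ q.1 ∧ d q = 0 ∧ ∀ r, d r = 1 → q < r := fun q hq => by
    simpa [freeEntries] using hY hq
  rw [← card_union_of_disjoint]
  · congr 1
    ext p
    simp only [freeEntries, blockedEntries, mem_filter, mem_univ, mem_union, true_and,
      extendShape_eq_zero, extendShape_eq_one]
    constructor
    · rintro ⟨h1, ⟨h2, h3⟩, h4⟩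
      have h5 : i + 1 ≤ p.1 := by
        by_contra h
        exact h4 fun r hr => Fin.lt_def.2 (by have := (hY1 r hr).1; omega)
      by_cases h6 : ∀ r, d r = 1 → p < r
      · exact Or.inr ⟨⟨h5, h3, h6⟩, h2, h4⟩
      · exact Or.inl ⟨h5, h3, h6⟩
    · rintro (⟨h1, h2, h3⟩ | ⟨⟨h1, h2, h3⟩, h4, h5⟩)
      · refine ⟨by omega, ⟨fun h => h3 (hY1 p h).2.2, h2⟩, fun h => h3 fun r hr => ?_⟩
        obtain ⟨q, hq⟩ := nonempty_iff_ne_empty.2 hY0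
        exact (h q hq).trans ((hY1 q hq).2.2 r hr)
      · exact ⟨by omega, ⟨h4, h2⟩, h5⟩
  · rw [disjoint_left]
    simp +contextual [freeEntries, blockedEntries]

lemma card_avoidingTables_shape_succ {n i : ℕ} (d : Fin n → ℕ) :
    #{a ∈ avoidingTables n | ∀ p, a p - (i + 1) = d p} =
      ∑ Y ∈ (freeEntries (i + 1) d).powerset,
        #{a ∈ avoidingTables n | ∀ p, a p - i = extendShape d Y p} := by
  rw [card_eq_sum_card_fiberwise (f := fun a => ({p | a p = i + 1} : Finset (Fin n)))
    (t := (freeEntries (i + 1) d).powerset)]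
  · refine sum_congr rfl fun Y hY => ?_
    congr 1
    ext a
    simp only [mem_filter, and_assoc, and_congr_right_iff]
    intro ha
    constructor
    · rintro ⟨h1, rfl⟩ p
      have := h1 p
      simp only [extendShape, mem_filter, mem_univ, true_and]
      split_ifs <;> omega
    · intro h
      refine ⟨fun p => ?_, ?_⟩
      · have := h p
        by_cases hp : p ∈ Y
        · have h0 : d p = 0 := by
            have := mem_powerset.1 hY hp
            simp only [freeEntries, mem_filter] at this
            exact this.2.2.1
          simp only [extendShape, hp, if_true] at this
          omega
        · simp only [extendShape, hp, if_false] at this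
          split_ifs at this <;> omega
      · ext p
        simp only [mem_filter, mem_univ, true_and]
        rw [← extendShape_eq_one (d := d), ← h p]
        omega
  · intro a ha
    simp only [coe_filter, Set.mem_ofPred_eq, mem_avoidingTables] at ha
    obtain ⟨⟨h1, h2⟩, h3⟩ := ha
    simp only [coe_powerset, Set.mem_preimage, Set.mem_powerset_iff, coe_subset]
    intro p hp
    simp only [mem_filter, mem_univ, true_and] at hp
    simp only [freeEntries, mem_filter, mem_univ, true_and]
    have := h1 p
    have := h3 p
    refine ⟨by omega, by omega, fun r hr => ?_⟩
    have := h3 r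
    by_contra! hlt
    rcases hlt.lt_or_eq with hlt | rfl
    · exact h2 r p hlt (by omega)
    · omega

lemma transfer_blocked_free (f : ℕ → ℕ → ℤ⟦X⟧) {n i : ℕ} (hi : i < n) {d : Fin n → ℕ}
    (hd : d ⟨i, hi⟩ = 0) :
    transfer f #(blockedEntries (i + 1) d) #(freeEntries (i + 1) d) =
      ∑ Y ∈ (freeEntries (i + 1) d).powerset,
        f #(blockedEntries i (extendShape d Y)) #(freeEntries i (extendShape d Y)) := by
  rw [transfer_apply, ← sum_powerset_nonempty _ fun r t =>
      f (#(blockedEntries (i + 1) d) + r) (t + 1),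
    ← add_sum_erase _ _ (empty_mem_powerset _), ← add_sum_erase _ _ (empty_mem_powerset _),
    card_blockedEntries_empty, card_freeEntries_empty hi hd, if_pos rfl, zero_add]
  congr 1
  refine sum_congr rfl fun Y hY => ?_
  obtain ⟨h0, hY⟩ := mem_erase.1 hY
  rw [if_neg h0, card_freeEntries hi hd (mem_powerset.1 hY) h0,
    card_blockedEntries (mem_powerset.1 hY) h0]
  congr!

lemma card_avoidingTables_shape {n i : ℕ} (hi : i ≤ n) {d : Fin n → ℕ}
    (hd : ∀ p, d p ≤ p.1 - i) (hd' : ∀ p q, p < q → 0 < d q → d p ≠ d q + 1) :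
    (#{a ∈ avoidingTables n | ∀ p, a p - i = d p} : ℤ⟦X⟧) =
      (transfer ^ i) (expFun 0 1) #(blockedEntries i d) #(freeEntries i d) := by
  induction i generalizing d with
  | zero =>
    have h1 : ({a ∈ avoidingTables n | ∀ p, a p - 0 = d p} : Finset _) =
        {a ∈ avoidingTables n | a = d} := by
      simp only [Nat.sub_zero, funext_iff]
    rw [h1, filter_eq']
    simp only [pow_zero, Module.End.one_apply, expFun, one_pow, mul_one]
    split_ifs with h
    · have h2 : #(blockedEntries 0 d) = 0 := by
        rw [mem_avoidingTables] at h
        simp only [blockedEntries, card_eq_zero, filter_eq_empty_iff, mem_univ, true_implies,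
          not_and, not_not]
        intro q _ hq r hr
        by_contra! hlt
        rcases hlt.lt_or_eq with hlt | rfl
        · exact h.2 r q hlt (by omega)
        · omega
      simp [h2]
    · have h2 : #(blockedEntries 0 d) ≠ 0 := by
        intro h2
        simp only [blockedEntries, card_eq_zero, filter_eq_empty_iff, mem_univ, true_implies,
          not_and, not_not] at h2
        refine h (mem_avoidingTables.2 ⟨hd, fun p q hpq hpq' => ?_⟩)
        rcases Nat.eq_zero_or_pos (d q) with h0 | h0
        · exact lt_asymm hpq (h2 (Nat.zero_le _) h0 p (by omega))
        · exact hd' p q hpq h0 hpq'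
      simp [h2]
  | succ i ih =>
    have hd0 : d ⟨i, hi⟩ = 0 := by
      have := hd ⟨i, hi⟩
      simp only at this
      omega
    rw [card_avoidingTables_shape_succ, pow_succ', Module.End.mul_apply,
      transfer_blocked_free _ hi hd0, Nat.cast_sum]
    refine sum_congr rfl fun Y hY => ih (Nat.le_of_succ_le hi) (fun p => ?_) fun p q hpq h0 h => ?_
    all_goals
      have hY1 : ∀ q ∈ Y, i + 1 ≤ q.1 ∧ d q = 0 ∧ ∀ r, d r = 1 → q < r := fun q hq => by
        simpa [freeEntries] using mem_powerset.1 hY hq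
    · have h1 := hd p
      have h2 := hY1 p
      unfold extendShape
      split_ifs with h3
      · have := (h2 h3).1
        omega
      · omega
      · omega
    · unfold extendShape at h0 h
      by_cases hq : q ∈ Y
      · have h1 := (hY1 q hq).2.2 p
        simp only [hq, if_true] at h
        refine lt_asymm hpq (h1 ?_)
        split_ifs at h <;> omega
      · simp only [hq, if_false] at h h0
        have h1 := hd' p q hpq
        split_ifs at h h0 <;> omega

lemma card_avoidingTables (n : ℕ) :
    (#(avoidingTables n) : ℤ⟦X⟧) = (transfer ^ n) (expFun 0 1) 0 0 := by
  have h := card_avoidingTables_shape (n := n) le_rfl (d := 0) (by simp) (by simp)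
  have h1 : ({a ∈ avoidingTables n | ∀ p, a p - n = 0} : Finset _) = avoidingTables n := by
    refine filter_true_of_mem fun a ha p => ?_
    have := (mem_avoidingTables.1 ha).1 p
    omega
  have h2 (p : Fin n) : ¬ n ≤ p.1 := by omega
  simpa [h1, blockedEntries, freeEntries, h2] using h

lemma coeff_pathSum (n : ℕ) : coeff n (pathSum (expFun 0 1)) = #(avoidingTables n) := by
  simp only [pathSum, ← card_avoidingTables, xsum, coeff_mk]
  rw [sum_range_succ, sum_eq_zero, zero_add, Nat.sub_self, coeff_zero_eq_constantCoeff_apply,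
    map_natCast]
  intro k hk
  rw [← map_natCast (C (R := ℤ)), coeff_C, if_neg]
  have := mem_range.1 hk
  omega

lemma sum_nonempty_subsets (m : ℕ) :
    ∑ A ∈ (range m).powerset.erase ∅, (-1 : ℤ⟦X⟧) ^ (#A + 1) * X ^ #A = 1 - (1 - X) ^ m := by
  have h : ∑ A ∈ (range m).powerset, (-1 : ℤ⟦X⟧) ^ (#A + 1) * X ^ #A = -(1 - X) ^ m := by
    have := sum_pow_mul_eq_add_pow (-X : ℤ⟦X⟧) 1 (range m)
    rw [card_range] at this
    rw [sub_eq_neg_add, ← this, ← sum_neg_distrib]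
    refine sum_congr rfl fun A _ => ?_
    rw [neg_pow X]
    ring
  rw [← add_sum_erase _ _ (empty_mem_powerset _)] at h
  simp only [card_empty] at h
  linear_combination h

lemma sum_fishburnDiagrams (k : ℕ) :
    ∑ A ∈ fishburnDiagrams k, (-1 : ℤ⟦X⟧) ^ (dots A + k) * X ^ dots A =
      ∏ i ∈ range k, (1 - (1 - X) ^ (i + 1)) := by
  simp only [← sum_nonempty_subsets]
  rw [← Fin.prod_univ_eq_prod_range (fun i => ∑ A ∈ (range (i + 1)).powerset.erase ∅,
    (-1 : ℤ⟦X⟧) ^ (#A + 1) * X ^ #A), prod_univ_sum]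
  refine sum_congr rfl fun A _ => ?_
  rw [prod_mul_distrib, prod_pow_eq_pow_sum, prod_pow_eq_pow_sum, sum_add_distrib]
  simp [dots]

lemma sum_fishburnDiagrams_filter {n k : ℕ} (hk : k ≤ n) :
    ∑ A ∈ (fishburnDiagrams k).filter (fun A => dots A = n), (-1 : ℤ) ^ (n - k) =
      coeff (n - k) (∏ i ∈ range k, ∑ s ∈ range (1 + i), (1 - X : ℤ⟦X⟧) ^ s) := by
  have h : (X : ℤ⟦X⟧) ^ k * ∏ i ∈ range k, ∑ s ∈ range (1 + i), (1 - X : ℤ⟦X⟧) ^ s =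
      ∑ A ∈ fishburnDiagrams k, (-1 : ℤ⟦X⟧) ^ (dots A + k) * X ^ dots A := by
    rw [sum_fishburnDiagrams, pow_eq_prod_const, ← prod_mul_distrib]
    simp only [X_mul_geom_sum, add_comm 1]
  have h' := congrArg (coeff n) h
  rw [coeff_X_pow_mul', if_pos hk] at h'
  rw [h', map_sum, sum_filter]
  refine sum_congr rfl fun A _ => ?_
  have hc : (-1 : ℤ⟦X⟧) ^ (dots A + k) = C ((-1 : ℤ) ^ (dots A + k)) := by simp
  rw [hc, coeff_C_mul, coeff_X_pow]
  split_ifs with h1 h2 h2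
  · rw [h1, mul_one, show n + k = n - k + 2 * k by omega, pow_add, pow_mul]
    simp
  · exact absurd h1.symm h2
  · exact absurd h2.symm h1
  · simp

/-- For `n ≥ 1`, `Σ_{A ∈ Y_n} (-1)^{n-k} = |T_n|`, the sum over all Fishburn diagrams
with exactly `n` dots (`k` being the number of columns).  A diagram with `k` columns
has at least `k` dots, so summing over `k ≤ n` loses nothing. -/
theorem fishburn_diagram_signed_sum_eq_Tn (n : ℕ) (hn : 1 ≤ n) :
    (∑ k ∈ Finset.range (n + 1),
        ∑ A ∈ (fishburnDiagrams k).filter (fun A => dots A = n), ((-1 : ℤ)) ^ (n - k)) =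
      ({a : Fin n → ℕ | (∀ i, a i ≤ i.1) ∧
        ¬ ∃ p q : Fin n, p < q ∧ a p = a q + 1}.ncard : ℤ) := by
  have hT : {a : Fin n → ℕ | (∀ i, a i ≤ i.1) ∧ ¬ ∃ p q : Fin n, p < q ∧ a p = a q + 1} =
      avoidingTables n := by
    ext a
    simp [mem_avoidingTables]
  rw [hT, Set.ncard_coe_finset, ← coeff_pathSum, pathSum_eq_fishburnSeries, fishburnSeries, xsum,
    coeff_mk]
  refine Finset.sum_congr rfl fun k hk => ?_
  rw [sum_fishburnDiagrams_filter (Nat.lt_succ_iff.1 (mem_range.1 hk)), zero_mul, pow_zero, one_mul]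
end
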